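/- (FDTM stability with respect to the measure.) Let K ⊂ ℝ^d be a compact convex set, μ and ν probability measures with supp(μ) ⊂ K and supp(ν) ⊂ K, and F ⊂ K a closed nonempty set. Then for all x, y ∈ K, |D_{μ,F}(x,y) − D_{ν,F}(x,y)| ≤ λ · diam(K) · sup_{z ∈ K} |d_μ(z)^β − d_ν(z)^β|, where λ = 2c·ρ^{β+1}/(ρ − 1) with c = (16·5^β + 1152·165^β)/m^{2+β} and ρ = 1 + 32/m. -/

import Mathlib

open MeasureTheory Metric Set ProbabilityTheory
open scoped ENNReal NNReal

noncomputable section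

/-- Euclidean space `ℝ^d`. -/
abbrev Euc (d : ℕ) := EuclideanSpace ℝ (Fin d)

/-- The pseudo-distance-to-measure `δ_{μ,u}(x) = inf {r > 0 : μ(B(x,r)) > u}`. -/
def pseudoDTM {d : ℕ} (μ : Measure (Euc d)) (u : ℝ) (x : Euc d) : ℝ :=
  sInf {r : ℝ | 0 < r ∧ u < (μ (ball x r)).toReal}

/-- The distance-to-measure `d_μ(x) = ((1/m) ∫₀^m δ_{μ,u}(x)^p du)^{1/p}`. -/
def dtm {d : ℕ} (m p : ℝ) (μ : Measure (Euc d)) (x : Euc d) : ℝ :=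
  ((1 / m) * ∫ u in Ioc (0 : ℝ) m, pseudoDTM μ u x ^ p) ^ (1 / p)

/-- A Lipschitz path. -/
def IsLipschitzPath {d : ℕ} (γ : ℝ → Euc d) : Prop := ∃ K, LipschitzWith K γ

/-- Euclidean length `|γ| = ∫₀¹ ‖γ'(t)‖ dt`. -/
def eucLength {d : ℕ} (γ : ℝ → Euc d) : ℝ := ∫ t in Icc (0 : ℝ) 1, ‖deriv γ t‖

/-- FDTM length `D_μ(γ) = ∫₀¹ d_μ(γ(t))^β ‖γ'(t)‖ dt`. -/
def fdtmLength {d : ℕ} (m p β : ℝ) (μ : Measure (Euc d)) (γ : ℝ → Euc d) : ℝ :=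
  ∫ t in Icc (0 : ℝ) 1, dtm m p μ (γ t) ^ β * ‖deriv γ t‖

/-- Admissible paths `Γ_F(x,y)`: Lipschitz paths from `x` to `y` which may leave the domain `F`
only along straight lines. -/
def AdmissiblePath {d : ℕ} (F : Set (Euc d)) (x y : Euc d) (γ : ℝ → Euc d) : Prop :=
  IsLipschitzPath γ ∧ γ 0 = x ∧ γ 1 = y ∧
    ∀ a b : ℝ, 0 ≤ a → b ≤ 1 →
      (∀ t ∈ Ioo a b, γ t ∉ F) →
      ∃ u : Euc d, ‖u‖ = 1 ∧
        ∀ᵐ t ∂(volume.restrict (Ioo a b)), deriv γ t = ‖deriv γ t‖ • u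

/-- The Fermat distance-to-measure `D_{μ,F}(x,y) = inf_{γ ∈ Γ_F(x,y)} D_μ(γ)`. -/
def fdtm {d : ℕ} (m p β : ℝ) (μ : Measure (Euc d)) (F : Set (Euc d)) (x y : Euc d) : ℝ :=
  sInf {L : ℝ | ∃ γ : ℝ → Euc d, AdmissiblePath F x y γ ∧ L = fdtmLength m p β μ γ}

/-- A geodesic: an admissible path realizing the FDTM. -/
def IsGeodesic {d : ℕ} (m p β : ℝ) (μ : Measure (Euc d)) (F : Set (Euc d)) (x y : Euc d)
    (γ : ℝ → Euc d) : Prop :=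
  AdmissiblePath F x y γ ∧ fdtmLength m p β μ γ = fdtm m p β μ F x y

/-- FDTM length of the straight segment `[x,y]`. -/
def segFDTM {d : ℕ} (m p β : ℝ) (μ : Measure (Euc d)) (x y : Euc d) : ℝ :=
  ‖x - y‖ * ∫ t in Icc (0 : ℝ) 1, dtm m p μ ((1 - t) • x + t • y) ^ β

/-- The explicit constant `λ = 2·c·ρ^{β+1}/(ρ−1)` with `c = (16·5^β + 1152·165^β)/m^{2+β}`
and `ρ = 1 + 32/m`. -/
def fdtmConst (m β : ℝ) : ℝ :=
  2 * ((16 * (5 : ℝ) ^ β + 1152 * (165 : ℝ) ^ β) / m ^ (2 + β)) * (1 + 32 / m) ^ (β + 1) /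
    ((1 + 32 / m) - 1)

/-- Support of a measure: points all of whose neighborhoods have positive mass. -/
def measSupport {d : ℕ} (μ : Measure (Euc d)) : Set (Euc d) :=
  {x | ∀ r : ℝ, 0 < r → 0 < μ (ball x r)}

/-- `(a,b)`-standard measure: `μ(B(x,r)) ≥ a·r^b` for `x ∈ supp(μ)` and `0 < r ≤ a^{-1/b}`. -/
def IsStandard {d : ℕ} (μ : Measure (Euc d)) (a b : ℝ) : Prop :=
  ∀ x ∈ measSupport μ, ∀ r : ℝ, 0 < r → r ≤ a ^ (-(1 / b)) → a * r ^ b ≤ (μ (ball x r)).toReal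

lemma exists_lt_measure_ball {d : ℕ} (μ : Measure (Euc d)) [IsProbabilityMeasure μ] {u : ℝ}
    (hu : u < 1) (x : Euc d) : ∃ r : ℝ, 0 < r ∧ u < (μ (ball x r)).toReal := by
  have hmono : Monotone fun n : ℕ => ball x (n : ℝ) := fun a b hab =>
    ball_subset_ball (by exact_mod_cast hab)
  have h1 : ENNReal.ofReal u < ⨆ n : ℕ, μ (ball x n) := by
    rw [← hmono.measure_iUnion, iUnion_ball_nat, measure_univ]
    exact ENNReal.ofReal_lt_one.2 hu
  obtain ⟨n, hn⟩ := lt_iSup_iff.1 h1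
  have h2 : u < (μ (ball x n)).toReal := by
    by_contra! hle
    have := ENNReal.ofReal_le_ofReal hle
    rw [ENNReal.ofReal_toReal (measure_ne_top _ _)] at this
    exact absurd hn this.not_gt
  rcases Nat.eq_zero_or_pos n with rfl | hpos
  · simp at hn
  · exact ⟨n, by exact_mod_cast hpos, h2⟩

lemma pseudoDTM_bddBelow {d : ℕ} (μ : Measure (Euc d)) (u : ℝ) (x : Euc d) :
    BddBelow {r : ℝ | 0 < r ∧ u < (μ (ball x r)).toReal} := ⟨0, fun _ hr => hr.1.le⟩

lemma pseudoDTM_nonneg {d : ℕ} (μ : Measure (Euc d)) (u : ℝ) (x : Euc d) :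
    0 ≤ pseudoDTM μ u x := Real.sInf_nonneg fun _ hr => hr.1.le

lemma pseudoDTM_mono {d : ℕ} (μ : Measure (Euc d)) [IsProbabilityMeasure μ] {u v : ℝ}
    (huv : u ≤ v) (hv : v < 1) (x : Euc d) : pseudoDTM μ u x ≤ pseudoDTM μ v x :=
  csInf_le_csInf (pseudoDTM_bddBelow μ u x) (exists_lt_measure_ball μ hv x)
    fun _ hr => ⟨hr.1, huv.trans_lt hr.2⟩

lemma pseudoDTM_le_add_dist {d : ℕ} (μ : Measure (Euc d)) [IsProbabilityMeasure μ] {u : ℝ}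
    (hu : u < 1) (x y : Euc d) : pseudoDTM μ u x ≤ pseudoDTM μ u y + dist x y := by
  rw [← sub_le_iff_le_add]
  refine le_csInf (exists_lt_measure_ball μ hu y) fun r hr => ?_
  rw [sub_le_iff_le_add]
  refine csInf_le (pseudoDTM_bddBelow μ u x)
    ⟨by linarith [hr.1, dist_nonneg (x := x) (y := y)], ?_⟩
  refine hr.2.trans_le (ENNReal.toReal_mono (measure_ne_top _ _) (measure_mono ?_))
  exact ball_subset_ball' (by rw [dist_comm])

/-- The uniform probability measure on `(0, m]`. -/
def unifMass (m : ℝ) : Measure ℝ := ENNReal.ofReal (1 / m) • volume.restrict (Ioc (0 : ℝ) m)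

lemma isProbabilityMeasure_unifMass {m : ℝ} (hm : 0 < m) : IsProbabilityMeasure (unifMass m) := by
  constructor
  simp only [unifMass, Measure.smul_apply, smul_eq_mul, Measure.restrict_apply_univ,
    Real.volume_Ioc, sub_zero]
  rw [← ENNReal.ofReal_mul (by positivity), one_div_mul_cancel hm.ne', ENNReal.ofReal_one]

lemma memLp_pseudoDTM {d : ℕ} {m p : ℝ} (hm : m ∈ Ioo (0 : ℝ) 1)
    (μ : Measure (Euc d)) [IsProbabilityMeasure μ] (x : Euc d) :
    MemLp (fun u => pseudoDTM μ u x) (ENNReal.ofReal p) (unifMass m) := by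
  have := isProbabilityMeasure_unifMass hm.1
  have hmeas : AEMeasurable (fun u => pseudoDTM μ u x) (unifMass m) :=
    (aemeasurable_restrict_of_monotoneOn measurableSet_Ioc
      fun u _ v hv huv => pseudoDTM_mono μ huv (hv.2.trans_lt hm.2) x).smul_measure _
  refine MemLp.of_bound hmeas.aestronglyMeasurable (pseudoDTM μ m x) ?_
  refine Measure.ae_smul_measure ?_ _
  filter_upwards [ae_restrict_mem measurableSet_Ioc] with u hu
  rw [Real.norm_of_nonneg (pseudoDTM_nonneg μ u x)]
  exact pseudoDTM_mono μ hu.2 hm.2 x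

lemma integral_unifMass {m : ℝ} (hm : 0 < m) (f : ℝ → ℝ) :
    ∫ u, f u ∂(unifMass m) = (1 / m) * ∫ u in Ioc (0 : ℝ) m, f u := by
  rw [unifMass, integral_smul_measure, ENNReal.toReal_ofReal (by positivity), smul_eq_mul]

lemma ofReal_dtm {d : ℕ} {m p : ℝ} (hm : m ∈ Ioo (0 : ℝ) 1) (hp : 1 ≤ p)
    (μ : Measure (Euc d)) [IsProbabilityMeasure μ] (x : Euc d) :
    ENNReal.ofReal (dtm m p μ x) =
      eLpNorm (fun u => pseudoDTM μ u x) (ENNReal.ofReal p) (unifMass m) := by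
  rw [(memLp_pseudoDTM hm μ x).eLpNorm_eq_integral_rpow_norm
    (by simp; linarith) ENNReal.ofReal_ne_top, ENNReal.toReal_ofReal (by linarith),
    integral_unifMass hm.1, dtm, one_div p]
  simp only [Real.norm_of_nonneg (pseudoDTM_nonneg μ _ x)]

lemma dtm_nonneg {d : ℕ} {m : ℝ} (hm : 0 < m) (p : ℝ) (μ : Measure (Euc d)) (x : Euc d) :
    0 ≤ dtm m p μ x := by
  refine Real.rpow_nonneg (mul_nonneg (by positivity) (integral_nonneg fun u => ?_)) _
  exact Real.rpow_nonneg (pseudoDTM_nonneg μ u x) _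

lemma dtm_le_of_ae {d : ℕ} {m p : ℝ} (hm : m ∈ Ioo (0 : ℝ) 1) (hp : 1 ≤ p)
    (μ ν : Measure (Euc d)) [IsProbabilityMeasure μ] [IsProbabilityMeasure ν] (x y : Euc d)
    {c : ℝ} (hc : 0 ≤ c) (h : ∀ u ≤ m, pseudoDTM μ u x ≤ pseudoDTM ν u y + c) :
    dtm m p μ x ≤ dtm m p ν y + c := by
  have := isProbabilityMeasure_unifMass hm.1
  have hp' : 1 ≤ ENNReal.ofReal p := by simpa using hp
  rw [← ENNReal.ofReal_le_ofReal_iff (add_nonneg (dtm_nonneg hm.1 p ν y) hc),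
    ENNReal.ofReal_add (dtm_nonneg hm.1 p ν y) hc, ofReal_dtm hm hp, ofReal_dtm hm hp]
  calc eLpNorm (fun u => pseudoDTM μ u x) (ENNReal.ofReal p) (unifMass m)
      ≤ eLpNorm ((fun u => pseudoDTM ν u y) + fun _ => c) (ENNReal.ofReal p) (unifMass m) := by
        refine eLpNorm_mono_ae ?_
        refine Measure.ae_smul_measure ?_ _
        filter_upwards [ae_restrict_mem measurableSet_Ioc] with u hu
        rw [Real.norm_of_nonneg (pseudoDTM_nonneg μ u x)]
        exact (h u hu.2).trans (le_abs_self _)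
    _ ≤ _ := by
        refine (eLpNorm_add_le (memLp_pseudoDTM (p := p) hm ν y).1
          aestronglyMeasurable_const hp').trans ?_
        gcongr
        rw [eLpNorm_const _ (by positivity) (IsProbabilityMeasure.ne_zero _)]
        simp [Real.enorm_of_nonneg hc]

lemma dtm_le_add_dist {d : ℕ} {m p : ℝ} (hm : m ∈ Ioo (0 : ℝ) 1) (hp : 1 ≤ p)
    (μ : Measure (Euc d)) [IsProbabilityMeasure μ] (x y : Euc d) :
    dtm m p μ x ≤ dtm m p μ y + dist x y :=
  dtm_le_of_ae hm hp μ μ x y dist_nonneg fun _ hu =>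
    pseudoDTM_le_add_dist μ (hu.trans_lt hm.2) x y

lemma lipschitzWith_dtm {d : ℕ} {m p : ℝ} (hm : m ∈ Ioo (0 : ℝ) 1) (hp : 1 ≤ p)
    (μ : Measure (Euc d)) [IsProbabilityMeasure μ] : LipschitzWith 1 (dtm m p μ) :=
  LipschitzWith.of_le_add (dtm_le_add_dist hm hp μ)

lemma measure_eq_one_of_measSupport_subset {d : ℕ} {K : Set (Euc d)} (hK : IsCompact K)
    (μ : Measure (Euc d)) [IsProbabilityMeasure μ] (hμ : measSupport μ ⊆ K) : μ K = 1 := by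
  have hsub : μ.support ⊆ K := fun x hx =>
    hμ fun r hr => (Measure.mem_support_iff_forall x).1 hx _ (ball_mem_nhds x hr)
  rw [← prob_compl_eq_zero_iff hK.measurableSet]
  exact measure_mono_null (compl_subset_compl.2 hsub) Measure.measure_compl_support

lemma dtm_le_diam {d : ℕ} {m p : ℝ} (hm : m ∈ Ioo (0 : ℝ) 1) (hp : 1 ≤ p)
    {K : Set (Euc d)} (hK : IsCompact K)
    (μ : Measure (Euc d)) [IsProbabilityMeasure μ] (hμ : measSupport μ ⊆ K) {x : Euc d}
    (hx : x ∈ K) : dtm m p μ x ≤ diam K := by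
  have hδ : ∀ u ≤ m, pseudoDTM μ u x ≤ diam K := by
    intro u hu
    refine le_of_forall_pos_le_add fun ε hε => ?_
    have hb : K ⊆ ball x (diam K + ε) := fun z hz => by
      rw [mem_ball]; linarith [dist_le_diam_of_mem hK.isBounded hz hx]
    have h1 : μ (ball x (diam K + ε)) = 1 := le_antisymm prob_le_one
      ((measure_eq_one_of_measSupport_subset hK μ hμ).symm.le.trans (measure_mono hb))
    refine csInf_le (pseudoDTM_bddBelow μ u x) ⟨by positivity, ?_⟩
    rw [h1]; simpa using hu.trans_lt hm.2
  have := isProbabilityMeasure_unifMass hm.1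
  rw [← ENNReal.ofReal_le_ofReal_iff diam_nonneg, ofReal_dtm hm hp]
  have := eLpNorm_le_of_ae_bound (p := ENNReal.ofReal p) (μ := unifMass m)
    (f := fun u => pseudoDTM μ u x) (C := diam K) ?_
  · simpa using this
  · refine Measure.ae_smul_measure ?_ _
    filter_upwards [ae_restrict_mem measurableSet_Ioc] with u hu
    rw [Real.norm_of_nonneg (pseudoDTM_nonneg μ u x)]
    exact hδ u hu.2

lemma half_lt_measure_ball_of_dtm_le {d : ℕ} {m p : ℝ} (hm : m ∈ Ioo (0 : ℝ) 1) (hp : 1 ≤ p)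
    (μ : Measure (Euc d)) [IsProbabilityMeasure μ] {x : Euc d} {r : ℝ} (hr : 0 < r)
    (h : dtm m p μ x ≤ r) : m / 2 < (μ (ball x (3 * r))).toReal := by
  by_contra! hcon
  have hδ : ∀ u ∈ Ioc (m / 2) m, 3 * r ≤ pseudoDTM μ u x := by
    intro u hu
    refine le_csInf (exists_lt_measure_ball μ (hu.2.trans_lt hm.2) x) fun s hs => ?_
    by_contra! hlt
    have : (μ (ball x s)).toReal ≤ (μ (ball x (3 * r))).toReal :=
      ENNReal.toReal_mono (measure_ne_top _ _) (measure_mono (ball_subset_ball hlt.le))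
    linarith [hs.2, hu.1]
  have hint : IntegrableOn (fun u => pseudoDTM μ u x ^ p) (Ioc 0 m) := by
    have h1 := (memLp_pseudoDTM (p := p) hm μ x).integrable_norm_rpow
      (by simp; linarith) ENNReal.ofReal_ne_top
    rw [ENNReal.toReal_ofReal (by linarith)] at h1
    simp only [Real.norm_of_nonneg (pseudoDTM_nonneg μ _ x)] at h1
    rw [unifMass] at h1
    rwa [integrable_smul_measure (by simpa using hm.1) ENNReal.ofReal_ne_top] at h1
  have h1 : (m / 2) * (3 * r) ^ p ≤ ∫ u in Ioc (0 : ℝ) m, pseudoDTM μ u x ^ p := by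
    calc (m / 2) * (3 * r) ^ p = ∫ u in Ioc (m / 2) m, (3 * r) ^ p := by
          simp [hm.1.le]; ring_nf; simp
      _ ≤ ∫ u in Ioc (m / 2) m, pseudoDTM μ u x ^ p := by
          refine setIntegral_mono_on (by simp) (hint.mono_set (Ioc_subset_Ioc_left
            (by linarith [hm.1]))) measurableSet_Ioc fun u hu => ?_
          exact Real.rpow_le_rpow (by positivity) (hδ u hu) (by linarith)
      _ ≤ _ := setIntegral_mono_set hint
          (Filter.Eventually.of_forall fun u => Real.rpow_nonneg (pseudoDTM_nonneg μ u x) _)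
          (Ioc_subset_Ioc_left (by linarith [hm.1])).eventuallyLE
  have h2 : (1 / m) * ∫ u in Ioc (0 : ℝ) m, pseudoDTM μ u x ^ p ≤ r ^ p := by
    have h0 : 0 ≤ (1 / m) * ∫ u in Ioc (0 : ℝ) m, pseudoDTM μ u x ^ p :=
      mul_nonneg (by linarith [one_div_pos.2 hm.1])
        (integral_nonneg fun u => Real.rpow_nonneg (pseudoDTM_nonneg μ u x) _)
    have := Real.rpow_le_rpow (dtm_nonneg hm.1 p μ x) h (show 0 ≤ p by linarith)
    rwa [dtm, ← Real.rpow_mul h0, one_div_mul_cancel (by linarith), Real.rpow_one] at this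
  have h3 : (1 / m) * ((m / 2) * (3 * r) ^ p) ≤ r ^ p :=
    (mul_le_mul_of_nonneg_left h1 (one_div_pos.2 hm.1).le).trans h2
  rw [Real.mul_rpow (by norm_num) hr.le] at h3
  have h4 : (3 : ℝ) ≤ 3 ^ p := by
    simpa using Real.rpow_le_rpow_of_exponent_le (show (1 : ℝ) ≤ 3 by norm_num) hp
  have h5 : (0 : ℝ) < r ^ p := Real.rpow_pos_of_pos hr p
  have h6 : (1 / m) * ((m / 2) * (3 ^ p * r ^ p)) = (3 ^ p / 2) * r ^ p := by
    field_simp [hm.1.ne']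
  nlinarith

lemma card_mul_le_two_of_dtm_le {d : ℕ} {m p : ℝ} (hm : m ∈ Ioo (0 : ℝ) 1) (hp : 1 ≤ p)
    (μ : Measure (Euc d)) [IsProbabilityMeasure μ] {r : ℝ} (hr : 0 < r) (Z : Finset (Euc d))
    (hZ : ∀ z ∈ Z, dtm m p μ z ≤ r)
    (hsep : ∀ z ∈ Z, ∀ w ∈ Z, z ≠ w → 6 * r ≤ dist z w) : (Z.card : ℝ) * m ≤ 2 := by
  have hdisj : (Z : Set (Euc d)).PairwiseDisjoint fun z => ball z (3 * r) := by
    intro z hz w hw hzw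
    exact ball_disjoint_ball (by linarith [hsep z hz w hw hzw])
  have h1 : μ.real (⋃ z ∈ Z, ball z (3 * r)) = ∑ z ∈ Z, μ.real (ball z (3 * r)) :=
    measureReal_biUnion_finset hdisj fun _ _ => measurableSet_ball
  have h2 : ∑ z ∈ Z, m / 2 ≤ ∑ z ∈ Z, μ.real (ball z (3 * r)) :=
    Finset.sum_le_sum fun z hz => (half_lt_measure_ball_of_dtm_le hm hp μ hr (hZ z hz)).le
  rw [Finset.sum_const, nsmul_eq_mul] at h2
  have h3 : μ.real (⋃ z ∈ Z, ball z (3 * r)) ≤ 1 := measureReal_le_one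
  linarith

/-- Length of the part of a path between the times `s` and `t`, with respect to the weight `g`. -/
def weightedLength {d : ℕ} (g : Euc d → ℝ) (γ : ℝ → Euc d) (s t : ℝ) : ℝ :=
  ∫ τ in s..t, g (γ τ) * ‖deriv γ τ‖

lemma intervalIntegrable_speed {d : ℕ} {γ : ℝ → Euc d} {C : ℝ≥0} (hγ : LipschitzWith C γ)
    (s t : ℝ) : IntervalIntegrable (fun τ => ‖deriv γ τ‖) volume s t := by
  refine (intervalIntegrable_const (c := (C : ℝ))).mono_fun
    (measurable_deriv γ).norm.aestronglyMeasurable (Filter.Eventually.of_forall fun τ => ?_)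
  simp only [norm_norm, NNReal.norm_eq]
  exact norm_deriv_le_of_lipschitz hγ

lemma intervalIntegrable_weightedLength {d : ℕ} {g : Euc d → ℝ} (hg : Continuous g)
    {γ : ℝ → Euc d} {C : ℝ≥0} (hγ : LipschitzWith C γ) (s t : ℝ) :
    IntervalIntegrable (fun τ => g (γ τ) * ‖deriv γ τ‖) volume s t :=
  (intervalIntegrable_speed hγ s t).continuousOn_mul (hg.comp hγ.continuous).continuousOn

lemma fdtmLength_eq_weightedLength {d : ℕ} (m p β : ℝ) (μ : Measure (Euc d)) (γ : ℝ → Euc d) :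
    fdtmLength m p β μ γ = weightedLength (fun z => dtm m p μ z ^ β) γ 0 1 := by
  rw [fdtmLength, weightedLength, intervalIntegral.integral_of_le zero_le_one,
    integral_Icc_eq_integral_Ioc]

lemma weightedLength_nonneg {d : ℕ} {g : Euc d → ℝ} (hg : ∀ z, 0 ≤ g z) (γ : ℝ → Euc d)
    {s t : ℝ} (hst : s ≤ t) : 0 ≤ weightedLength g γ s t :=
  intervalIntegral.integral_nonneg hst fun _ _ => mul_nonneg (hg _) (norm_nonneg _)

/-- The path that agrees with `γ` outside `[s, t]` and follows the straight segment from `γ s` to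
`γ t` in between. -/
def shortcut {d : ℕ} (γ : ℝ → Euc d) (s t τ : ℝ) : Euc d :=
  (γ (min τ s) - γ s) + (γ (max τ t) - γ t) +
    (γ s + (max s (min τ t) - s) • ((t - s)⁻¹ • (γ t - γ s)))

lemma shortcut_of_le {d : ℕ} (γ : ℝ → Euc d) {s t τ : ℝ} (hst : s ≤ t) (hτ : τ ≤ s) :
    shortcut γ s t τ = γ τ := by
  simp [shortcut, hτ, hτ.trans hst]

lemma shortcut_of_ge {d : ℕ} (γ : ℝ → Euc d) {s t τ : ℝ} (hst : s < t) (hτ : t ≤ τ) :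
    shortcut γ s t τ = γ τ := by
  have : (t - s) • (t - s)⁻¹ • (γ t - γ s) = γ t - γ s := smul_inv_smul₀ (by linarith) _
  simp [shortcut, hτ, hst.le.trans hτ, hst.le, this]

lemma shortcut_of_mem {d : ℕ} (γ : ℝ → Euc d) {s t τ : ℝ} (hs : s ≤ τ) (ht : τ ≤ t) :
    shortcut γ s t τ = γ s + (τ - s) • ((t - s)⁻¹ • (γ t - γ s)) := by
  simp [shortcut, hs, ht]

lemma isLipschitzPath_shortcut {d : ℕ} {γ : ℝ → Euc d} (hγ : IsLipschitzPath γ) (s t : ℝ) :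
    IsLipschitzPath (shortcut γ s t) := by
  obtain ⟨C, hC⟩ := hγ
  have haff : ∀ v w : Euc d, LipschitzWith ‖v‖₊ fun σ : ℝ => w + (σ - s) • v := fun v w =>
    LipschitzWith.of_dist_le_mul fun a b => by
      rw [dist_add_left, dist_eq_norm, ← sub_smul, norm_smul, sub_sub_sub_cancel_right,
        mul_comm, coe_nnnorm, Real.dist_eq, Real.norm_eq_abs]
  have h1 := hC.comp (LipschitzWith.id.min_const s)
  have h2 := hC.comp (LipschitzWith.id.max_const t)
  have h3 := (haff ((t - s)⁻¹ • (γ t - γ s)) (γ s)).comp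
    ((LipschitzWith.id.min_const t).const_max s)
  exact ⟨_, ((h1.sub (LipschitzWith.const (γ s))).add (h2.sub (LipschitzWith.const (γ t)))).add h3⟩

lemma deriv_shortcut_of_lt {d : ℕ} (γ : ℝ → Euc d) {s t τ : ℝ} (hst : s ≤ t) (hτ : τ < s) :
    deriv (shortcut γ s t) τ = deriv γ τ := by
  refine Filter.EventuallyEq.deriv_eq ?_
  filter_upwards [Iio_mem_nhds hτ] with σ hσ using shortcut_of_le γ hst (le_of_lt hσ)

lemma deriv_shortcut_of_gt {d : ℕ} (γ : ℝ → Euc d) {s t τ : ℝ} (hst : s < t) (hτ : t < τ) :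
    deriv (shortcut γ s t) τ = deriv γ τ := by
  refine Filter.EventuallyEq.deriv_eq ?_
  filter_upwards [Ioi_mem_nhds hτ] with σ hσ using shortcut_of_ge γ hst (le_of_lt hσ)

lemma deriv_shortcut_of_mem {d : ℕ} (γ : ℝ → Euc d) {s t τ : ℝ} (hτ : τ ∈ Ioo s t) :
    deriv (shortcut γ s t) τ = (t - s)⁻¹ • (γ t - γ s) := by
  have h : shortcut γ s t =ᶠ[nhds τ] fun σ => γ s + (σ - s) • ((t - s)⁻¹ • (γ t - γ s)) := by
    filter_upwards [Ioo_mem_nhds hτ.1 hτ.2] with σ hσ using shortcut_of_mem γ hσ.1.le hσ.2.le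
  rw [h.deriv_eq]
  have : HasDerivAt (fun σ : ℝ => γ s + (σ - s) • ((t - s)⁻¹ • (γ t - γ s)))
      ((1 : ℝ) • ((t - s)⁻¹ • (γ t - γ s))) τ :=
    (((hasDerivAt_id τ).sub_const s).smul_const _).const_add _
  rw [this.deriv, one_smul]

/-- The times at which an admissible path may change direction freely. -/
def anchorTimes {d : ℕ} (F : Set (Euc d)) (γ : ℝ → Euc d) : Set ℝ :=
  {τ | τ ∈ Icc (0 : ℝ) 1 ∧ (τ = 0 ∨ τ = 1 ∨ γ τ ∈ F)}

lemma admissiblePath_shortcut {d : ℕ} {F : Set (Euc d)} {x y : Euc d} {γ : ℝ → Euc d}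
    (hγ : AdmissiblePath F x y γ) {s t : ℝ} (hst : s < t) (hs : s ∈ anchorTimes F γ)
    (ht : t ∈ anchorTimes F γ) : AdmissiblePath F x y (shortcut γ s t) := by
  obtain ⟨hL, h0, h1, hline⟩ := hγ
  refine ⟨isLipschitzPath_shortcut hL s t, ?_, ?_, fun a b ha hb hF => ?_⟩
  · rw [shortcut_of_le γ hst.le hs.1.1, h0]
  · rw [shortcut_of_ge γ hst ht.1.2, h1]
  obtain ⟨w, hw, -⟩ := hline 0 0 le_rfl zero_le_one (by simp)
  rcases le_or_gt b a with hab | hab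
  · exact ⟨w, hw, by simp [hab]⟩
  rcases le_or_gt b s with hbs | hbs
  · obtain ⟨u, hu, hau⟩ := hline a b ha hb fun τ hτ => by
      rw [← shortcut_of_le γ hst.le (hτ.2.le.trans hbs)]; exact hF τ hτ
    refine ⟨u, hu, ?_⟩
    filter_upwards [hau, ae_restrict_mem measurableSet_Ioo] with τ h hτ
    rwa [deriv_shortcut_of_lt γ hst.le (hτ.2.trans_le hbs)]
  rcases le_or_gt t a with hta | hta
  · obtain ⟨u, hu, hau⟩ := hline a b ha hb fun τ hτ => by
      rw [← shortcut_of_ge γ hst (hta.trans hτ.1.le)]; exact hF τ hτ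
    refine ⟨u, hu, ?_⟩
    filter_upwards [hau, ae_restrict_mem measurableSet_Ioo] with τ h hτ
    rwa [deriv_shortcut_of_gt γ hst (hta.trans_lt hτ.1)]
  have hsa : s ≤ a := by
    by_contra! has
    rcases hs.2 with h | h | h
    · linarith
    · linarith
    · exact hF s ⟨has, hbs⟩ (by rwa [shortcut_of_le γ hst.le le_rfl])
  have hbt : b ≤ t := by
    by_contra! htb
    rcases ht.2 with h | h | h
    · linarith
    · linarith
    · exact hF t ⟨hta, htb⟩ (by rwa [shortcut_of_ge γ hst le_rfl])
  obtain ⟨u, hu, hau⟩ : ∃ u : Euc d, ‖u‖ = 1 ∧ (t - s)⁻¹ • (γ t - γ s) =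
      ‖(t - s)⁻¹ • (γ t - γ s)‖ • u := by
    by_cases hv : (t - s)⁻¹ • (γ t - γ s) = 0
    · exact ⟨w, hw, by simp [hv]⟩
    · exact ⟨_, norm_smul_inv_norm (𝕜 := ℝ) hv,
        by simp only [RCLike.ofReal_real_eq_id, id]; rw [smul_inv_smul₀ (norm_ne_zero_iff.2 hv)]⟩
  refine ⟨u, hu, ?_⟩
  filter_upwards [ae_restrict_mem measurableSet_Ioo] with τ hτ
  rwa [deriv_shortcut_of_mem γ ⟨hsa.trans_lt hτ.1, hτ.2.trans_le hbt⟩]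

lemma weightedLength_shortcut_le {d : ℕ} {g : Euc d → ℝ} (hg : Continuous g) {γ : ℝ → Euc d}
    (hγ : IsLipschitzPath γ) {s t : ℝ} (hst : s < t) {M : ℝ}
    (hM : ∀ z ∈ segment ℝ (γ s) (γ t), g z ≤ M) :
    weightedLength g (shortcut γ s t) s t ≤ M * ‖γ t - γ s‖ := by
  obtain ⟨C, hC⟩ := isLipschitzPath_shortcut hγ s t
  have hts : 0 < t - s := by linarith
  calc weightedLength g (shortcut γ s t) s t
      ≤ ∫ τ in s..t, M * ‖(t - s)⁻¹ • (γ t - γ s)‖ := by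
        refine intervalIntegral.integral_mono_on_of_le_Ioo hst.le
          (intervalIntegrable_weightedLength hg hC s t) intervalIntegrable_const fun τ hτ => ?_
        rw [deriv_shortcut_of_mem γ hτ]
        refine mul_le_mul_of_nonneg_right (hM _ ?_) (norm_nonneg _)
        rw [shortcut_of_mem γ hτ.1.le hτ.2.le, smul_smul, segment_eq_image']
        refine ⟨(τ - s) * (t - s)⁻¹, ⟨mul_nonneg (by linarith [hτ.1]) (by positivity), ?_⟩, rfl⟩
        rw [← div_eq_mul_inv, div_le_one hts]
        linarith [hτ.2]
    _ = M * ‖γ t - γ s‖ := by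
        rw [intervalIntegral.integral_const, norm_smul, norm_inv, Real.norm_of_nonneg hts.le,
          smul_eq_mul]
        field_simp

lemma weightedLength_add {d : ℕ} {g : Euc d → ℝ} (hg : Continuous g) {γ : ℝ → Euc d}
    (hγ : IsLipschitzPath γ) (a b c : ℝ) :
    weightedLength g γ a b + weightedLength g γ b c = weightedLength g γ a c := by
  obtain ⟨C, hC⟩ := hγ
  exact intervalIntegral.integral_add_adjacent_intervals
    (intervalIntegrable_weightedLength hg hC _ _) (intervalIntegrable_weightedLength hg hC _ _)

/-- A nearly optimal path is nearly as cheap as the chord between any two anchor times. -/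
lemma weightedLength_le_of_nearly_optimal {d : ℕ} {F : Set (Euc d)} {x y : Euc d} {γ : ℝ → Euc d}
    (hγ : AdmissiblePath F x y γ) {g : Euc d → ℝ} (hg : Continuous g) {ε : ℝ}
    (hε : 0 ≤ ε)
    (hopt : ∀ γ', AdmissiblePath F x y γ' → weightedLength g γ 0 1 ≤ weightedLength g γ' 0 1 + ε)
    {s t : ℝ} (hst : s ≤ t) (hs : s ∈ anchorTimes F γ) (ht : t ∈ anchorTimes F γ) {M : ℝ}
    (hM : ∀ z ∈ segment ℝ (γ s) (γ t), g z ≤ M) :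
    weightedLength g γ s t ≤ M * ‖γ t - γ s‖ + ε := by
  rcases hst.eq_or_lt with rfl | hst
  · simpa [weightedLength] using hε
  have h1 := hopt _ (admissiblePath_shortcut hγ hst hs ht)
  have h2 := weightedLength_shortcut_le hg hγ.1 hst hM
  have hL := isLipschitzPath_shortcut hγ.1 s t
  rw [← weightedLength_add hg hL 0 s 1, ← weightedLength_add hg hL s t 1,
    ← weightedLength_add hg hγ.1 0 s 1, ← weightedLength_add hg hγ.1 s t 1] at h1
  have h3 : weightedLength g (shortcut γ s t) 0 s = weightedLength g γ 0 s := by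
    refine intervalIntegral.integral_congr_Ioo_of_le hs.1.1 fun τ hτ => ?_
    rw [deriv_shortcut_of_lt γ hst.le hτ.2, shortcut_of_le γ hst.le hτ.2.le]
  have h4 : weightedLength g (shortcut γ s t) t 1 = weightedLength g γ t 1 := by
    refine intervalIntegral.integral_congr_Ioo_of_le ht.1.2 fun τ hτ => ?_
    rw [deriv_shortcut_of_gt γ hst hτ.1, shortcut_of_ge γ hst hτ.1.le]
  linarith

lemma sub_eq_integral_speed_smul {d : ℕ} {γ : ℝ → Euc d} (hγ : IsLipschitzPath γ) {a b : ℝ}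
    {u : Euc d} (hu : ∀ᵐ t ∂(volume.restrict (Ioo a b)), deriv γ t = ‖deriv γ t‖ • u) {s t : ℝ}
    (has : a ≤ s) (hst : s ≤ t) (htb : t ≤ b) :
    γ t - γ s = (∫ τ in s..t, ‖deriv γ τ‖) • u := by
  obtain ⟨C, hC⟩ := hγ
  refine ext_inner_left ℝ fun w => ?_
  have hw : LipschitzWith (‖innerSL ℝ w‖₊ * C) fun τ => inner ℝ w (γ τ) :=
    (innerSL ℝ w).lipschitz.comp hC
  have h1 : ∫ τ in s..t, deriv (fun τ => inner ℝ w (γ τ)) τ = inner ℝ w (γ t) - inner ℝ w (γ s) :=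
    (hw.lipschitzOnWith (s := uIcc s t)).absolutelyContinuousOnInterval.integral_deriv_eq_sub
  rw [inner_sub_right, ← h1, inner_smul_right, ← intervalIntegral.integral_mul_const]
  rw [intervalIntegral.integral_of_le hst, intervalIntegral.integral_of_le hst,
    integral_Ioc_eq_integral_Ioo, integral_Ioc_eq_integral_Ioo]
  refine integral_congr_ae ?_
  filter_upwards [ae_restrict_of_ae_restrict_of_subset (Ioo_subset_Ioo has htb) hu,
    ae_restrict_of_ae hC.ae_differentiableAt_real] with τ h hd
  have : HasDerivAt (fun τ => inner ℝ w (γ τ)) (inner ℝ w (deriv γ τ)) τ :=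
    (innerSL ℝ w).hasFDerivAt.comp_hasDerivAt τ hd.hasDerivAt
  rw [this.deriv]
  conv_lhs => rw [h]
  rw [inner_smul_right]

/-- `e` admits at most `2 / m` points in any `6 r`-separated subset of `{e ≤ r}`. -/
def HasPacking {d : ℕ} (m : ℝ) (e : Euc d → ℝ) : Prop :=
  ∀ r : ℝ, 0 < r → ∀ Z : Finset (Euc d), (∀ z ∈ Z, e z ≤ r) →
    (∀ z ∈ Z, ∀ w ∈ Z, z ≠ w → 6 * r ≤ dist z w) → (Z.card : ℝ) * m ≤ 2

/-- The set of times between which `γ` moves straight in the direction `u`. -/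
def IsStraightOn {d : ℕ} (γ : ℝ → Euc d) (u : Euc d) (a b : ℝ) : Prop :=
  ∀ᵐ t ∂(volume.restrict (Ioo a b)), deriv γ t = ‖deriv γ t‖ • u

lemma integral_speed_nonneg {d : ℕ} (γ : ℝ → Euc d) {s t : ℝ} (hst : s ≤ t) :
    0 ≤ ∫ τ in s..t, ‖deriv γ τ‖ :=
  intervalIntegral.integral_nonneg hst fun _ _ => norm_nonneg _

lemma IsStraightOn.norm_sub {d : ℕ} {γ : ℝ → Euc d} (hγ : IsLipschitzPath γ) {u : Euc d}
    (hu1 : ‖u‖ = 1) {a b : ℝ} (hu : IsStraightOn γ u a b) {s t : ℝ}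
    (has : a ≤ s) (hst : s ≤ t) (htb : t ≤ b) :
    ‖γ t - γ s‖ = ∫ τ in s..t, ‖deriv γ τ‖ := by
  rw [sub_eq_integral_speed_smul hγ hu has hst htb, norm_smul, hu1, mul_one,
    Real.norm_of_nonneg (integral_speed_nonneg γ hst)]

lemma IsStraightOn.norm_sub_add {d : ℕ} {γ : ℝ → Euc d} (hγ : IsLipschitzPath γ) {u : Euc d}
    (hu1 : ‖u‖ = 1) {a b : ℝ} (hu : IsStraightOn γ u a b) {s t : ℝ}
    (has : a ≤ s) (hst : s ≤ t) (htb : t ≤ b) :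
    ‖γ s - γ a‖ + ‖γ t - γ s‖ = ‖γ t - γ a‖ := by
  rw [hu.norm_sub hγ hu1 le_rfl has (hst.trans htb), hu.norm_sub hγ hu1 has hst htb,
    hu.norm_sub hγ hu1 le_rfl (has.trans hst) htb]
  obtain ⟨C, hC⟩ := hγ
  exact intervalIntegral.integral_add_adjacent_intervals (intervalIntegrable_speed hC _ _)
    (intervalIntegrable_speed hC _ _)

lemma IsStraightOn.mem_segment {d : ℕ} {γ : ℝ → Euc d} (hγ : IsLipschitzPath γ) {u : Euc d}
    (hu1 : ‖u‖ = 1) {a b : ℝ} (hu : IsStraightOn γ u a b) {s : ℝ} (has : a ≤ s) (hsb : s ≤ b) :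
    γ s ∈ segment ℝ (γ a) (γ b) := by
  rw [mem_segment_iff_wbtw, ← dist_add_dist_eq_iff, dist_eq_norm, dist_eq_norm,
    dist_eq_norm, norm_sub_rev (γ a) (γ s), norm_sub_rev (γ s) (γ b), norm_sub_rev (γ a) (γ b)]
  exact hu.norm_sub_add hγ hu1 has hsb le_rfl

/-- On a straight stretch, some subinterval of definite length stays away from the small values
of `e`. -/
lemma exists_subinterval_lt {d : ℕ} {m : ℝ} (hm : m ∈ Ioo (0 : ℝ) 1) {e : Euc d → ℝ}
    (he : LipschitzWith 1 e) (hpack : HasPacking m e) {γ : ℝ → Euc d} (hγ : IsLipschitzPath γ)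
    {u : Euc d} (hu1 : ‖u‖ = 1) {a b : ℝ} (hab : a ≤ b) (hu : IsStraightOn γ u a b)
    (hL : 0 < ‖γ b - γ a‖) :
    ∃ s t, a ≤ s ∧ s ≤ t ∧ t ≤ b ∧ ‖γ t - γ s‖ = m * ‖γ b - γ a‖ / 36 ∧
      ∀ τ ∈ Icc s t, m * ‖γ b - γ a‖ / 36 ≤ e (γ τ) := by
  set L := ‖γ b - γ a‖ with hLdef
  obtain ⟨hm0, hm1⟩ := hm
  have hcont : Continuous γ := by obtain ⟨C, hC⟩ := hγ; exact hC.continuous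
  have hivt : ∀ ℓ ∈ Icc 0 L, ∃ τ ∈ Icc a b, ‖γ τ - γ a‖ = ℓ := by
    intro ℓ hℓ
    have := intermediate_value_Icc hab (f := fun τ => ‖γ τ - γ a‖) (by fun_prop)
    simp only [sub_self, norm_zero] at this
    exact this hℓ
  have hmono : ∀ σ ∈ Icc a b, ∀ τ ∈ Icc a b, ‖γ σ - γ a‖ < ‖γ τ - γ a‖ → σ ≤ τ := by
    intro σ hσ τ hτ h
    by_contra! hlt
    have := hu.norm_sub_add hγ hu1 hτ.1 hlt.le hσ.2
    linarith [norm_nonneg (γ σ - γ τ)]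
  have hdist : ∀ σ ∈ Icc a b, ∀ τ ∈ Icc a b, σ ≤ τ →
      ‖γ τ - γ σ‖ = ‖γ τ - γ a‖ - ‖γ σ - γ a‖ := by
    intro σ hσ τ hτ h
    linarith [hu.norm_sub_add hγ hu1 hσ.1 h hτ.2]
  have hfar : ∃ p ∈ Icc a b, 2 * (m * L / 36) < e (γ p) := by
    by_contra! hcon
    set N := ⌈2 / m⌉₊ with hN
    have hN1 : 2 / m ≤ N := Nat.le_ceil _
    have hN2 : (N : ℝ) < 2 / m + 1 := Nat.ceil_lt_add_one (by positivity)
    have hNpos : (0 : ℝ) < N := lt_of_lt_of_le (by positivity) hN1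
    have hNm : (N : ℝ) * m ≤ 3 := by
      have : (N : ℝ) * m < (2 / m + 1) * m := by gcongr
      rw [add_mul, div_mul_cancel₀ _ hm0.ne'] at this
      linarith
    have hex : ∀ j : Fin (N + 1), ∃ τ ∈ Icc a b, ‖γ τ - γ a‖ = j * (L / N) := by
      intro j
      refine hivt _ ⟨by positivity, ?_⟩
      have : (j : ℝ) ≤ N := by exact_mod_cast Nat.lt_succ_iff.1 j.2
      calc (j : ℝ) * (L / N) ≤ N * (L / N) := by gcongr
        _ = L := by field_simp
    choose τ hτ hτℓ using hex
    have hgap : ∀ i j : Fin (N + 1), i < j → 6 * (2 * (m * L / 36)) ≤ dist (γ (τ i)) (γ (τ j)) := by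
      intro i j hij
      have hij' : (i : ℝ) + 1 ≤ j := by exact_mod_cast hij
      have hLN : 0 < L / N := by positivity
      have hle : τ i ≤ τ j := hmono _ (hτ i) _ (hτ j) (by rw [hτℓ, hτℓ]; nlinarith)
      rw [dist_comm, dist_eq_norm, hdist _ (hτ i) _ (hτ j) hle, hτℓ, hτℓ]
      have : m * L / 3 ≤ L / N := by
        rw [div_le_div_iff₀ (by norm_num) hNpos]
        nlinarith
      nlinarith
    have hne : ∀ i j : Fin (N + 1), i ≠ j →
        6 * (2 * (m * L / 36)) ≤ dist (γ (τ i)) (γ (τ j)) := by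
      intro i j hij
      rcases lt_or_gt_of_ne hij with h | h
      · exact hgap i j h
      · rw [dist_comm]; exact hgap j i h
    have hinj : Function.Injective fun i => γ (τ i) := by
      intro i j hij
      by_contra hne'
      have := hne i j hne'
      simp only at hij
      rw [hij, dist_self] at this
      have : 0 < m * L := by positivity
      linarith
    classical
    have hcard := hpack (2 * (m * L / 36)) (by positivity)
      (Finset.univ.image fun i => γ (τ i)) (by
        intro z hz
        obtain ⟨i, -, rfl⟩ := Finset.mem_image.1 hz
        exact hcon _ (hτ i)) (by
        intro z hz w hw hzw
        obtain ⟨i, -, rfl⟩ := Finset.mem_image.1 hz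
        obtain ⟨j, -, rfl⟩ := Finset.mem_image.1 hw
        exact hne i j fun h => hzw (by rw [h]))
    rw [Finset.card_image_of_injective _ hinj, Finset.card_univ, Fintype.card_fin] at hcard
    rw [div_le_iff₀ hm0] at hN1
    push_cast at hcard
    linarith
  obtain ⟨p, hp, hpe⟩ := hfar
  have hq : m * L / 36 ≤ L / 36 := by
    have : m * L ≤ 1 * L := by gcongr
    linarith
  have hq0 : 0 < m * L / 36 := by positivity
  have key : ∀ s ∈ Icc a b, ∀ t ∈ Icc a b, s ≤ t → (p = s ∨ p = t) →
      ‖γ t - γ s‖ = m * L / 36 → ∀ τ ∈ Icc s t, m * L / 36 ≤ e (γ τ) := by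
    intro s hs t ht hst hps hlen τ hτ
    have h1 := hdist s hs t ht hst
    have h2 := hdist s hs τ ⟨hs.1.trans hτ.1, hτ.2.trans ht.2⟩ hτ.1
    have h3 := hdist τ ⟨hs.1.trans hτ.1, hτ.2.trans ht.2⟩ t ht hτ.2
    have h4 : dist (γ p) (γ τ) ≤ m * L / 36 := by
      rcases hps with rfl | rfl
      · rw [dist_comm, dist_eq_norm]; linarith [norm_nonneg (γ t - γ τ)]
      · rw [dist_eq_norm]; linarith [norm_nonneg (γ τ - γ s)]
    have h5 := (abs_le.1 ((Real.dist_eq _ _).symm.le.trans (he.dist_le_mul (γ p) (γ τ)))).2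
    simp only [NNReal.coe_one, one_mul] at h5
    linarith
  rcases le_total ‖γ p - γ a‖ (L / 2) with h | h
  · obtain ⟨t, ht, htℓ⟩ := hivt (‖γ p - γ a‖ + m * L / 36)
      ⟨by positivity, by linarith⟩
    have hpt := hmono p hp t ht (by linarith)
    have hlen : ‖γ t - γ p‖ = m * L / 36 := by rw [hdist p hp t ht hpt]; linarith
    exact ⟨p, t, hp.1, hpt, ht.2, hlen, key p hp t ht hpt (Or.inl rfl) hlen⟩
  · obtain ⟨s, hs, hsℓ⟩ := hivt (‖γ p - γ a‖ - m * L / 36)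
      ⟨by linarith, by
        have := hu.norm_sub_add hγ hu1 hp.1 hp.2 le_rfl
        linarith [norm_nonneg (γ b - γ p)]⟩
    have hsp := hmono s hs p hp (by linarith)
    have hlen : ‖γ p - γ s‖ = m * L / 36 := by rw [hdist s hs p hp hsp]; linarith
    exact ⟨s, p, hs.1, hsp, hp.2, hlen, key s hs p hp hsp (Or.inr rfl) hlen⟩

lemma continuous_rpow_comp {d : ℕ} {β : ℝ} (hβ : 0 ≤ β) {e : Euc d → ℝ} (he : Continuous e) :
    Continuous fun z => e z ^ β := he.rpow_const fun _ => Or.inr hβ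

lemma rpow_le_weightedLength_of_isStraightOn {d : ℕ} {m β : ℝ} (hm : m ∈ Ioo (0 : ℝ) 1)
    (hβ : 1 ≤ β) {e : Euc d → ℝ} (he : LipschitzWith 1 e) (he0 : ∀ z, 0 ≤ e z)
    (hpack : HasPacking m e) {γ : ℝ → Euc d} (hγ : IsLipschitzPath γ)
    {u : Euc d} (hu1 : ‖u‖ = 1) {a b : ℝ} (hab : a ≤ b) (hu : IsStraightOn γ u a b) :
    (m * ‖γ b - γ a‖ / 36) ^ (β + 1) ≤ weightedLength (fun z => e z ^ β) γ a b := by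
  have hnn : ∀ z, 0 ≤ e z ^ β := fun z => Real.rpow_nonneg (he0 z) β
  rcases (norm_nonneg (γ b - γ a)).eq_or_lt with h0 | hL
  · rw [← h0, mul_zero, zero_div, Real.zero_rpow (by linarith)]
    exact weightedLength_nonneg hnn γ hab
  obtain ⟨s, t, has, hst, htb, hlen, hlow⟩ := exists_subinterval_lt hm he hpack hγ hu1 hab hu hL
  set q := m * ‖γ b - γ a‖ / 36
  have hq : 0 < q := by have := hm.1; positivity
  have hcont := continuous_rpow_comp (β := β) (by linarith) he.continuous
  have hst' := hu.norm_sub hγ hu1 has hst htb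
  obtain ⟨C, hC⟩ := hγ
  calc q ^ (β + 1) = ∫ τ in s..t, q ^ β * ‖deriv γ τ‖ := by
        rw [intervalIntegral.integral_const_mul, ← hst', hlen, Real.rpow_add_one hq.ne']
    _ ≤ weightedLength (fun z => e z ^ β) γ s t := by
        refine intervalIntegral.integral_mono_on hst
          ((intervalIntegrable_speed hC _ _).const_mul _)
          (intervalIntegrable_weightedLength hcont hC _ _) fun τ hτ => ?_
        exact mul_le_mul_of_nonneg_right
          (Real.rpow_le_rpow hq.le (hlow τ hτ) (by linarith)) (norm_nonneg _)
    _ ≤ _ := intervalIntegral.integral_mono_interval has hst htb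
        (Filter.Eventually.of_forall fun τ => mul_nonneg (hnn _) (norm_nonneg _))
        (intervalIntegrable_weightedLength hcont hC _ _)

section Anchors

/-- The last anchor time before `τ`. -/
def prevAnchor {d : ℕ} (F : Set (Euc d)) (γ : ℝ → Euc d) (τ : ℝ) : ℝ :=
  sSup (anchorTimes F γ ∩ Iic (max τ 0))

/-- The first anchor time after `τ`. -/
def nextAnchor {d : ℕ} (F : Set (Euc d)) (γ : ℝ → Euc d) (τ : ℝ) : ℝ :=
  sInf (anchorTimes F γ ∩ Ici (min τ 1))

/-- The length of the straight stretch around the time `τ`. -/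
def gapLength {d : ℕ} (F : Set (Euc d)) (γ : ℝ → Euc d) (τ : ℝ) : ℝ :=
  ‖γ (nextAnchor F γ τ) - γ (prevAnchor F γ τ)‖

variable {d : ℕ} {F : Set (Euc d)} {γ : ℝ → Euc d}

lemma zero_mem_anchorTimes (F : Set (Euc d)) (γ : ℝ → Euc d) : (0 : ℝ) ∈ anchorTimes F γ :=
  ⟨⟨le_rfl, zero_le_one⟩, Or.inl rfl⟩

lemma one_mem_anchorTimes (F : Set (Euc d)) (γ : ℝ → Euc d) : (1 : ℝ) ∈ anchorTimes F γ :=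
  ⟨⟨zero_le_one, le_rfl⟩, Or.inr (Or.inl rfl)⟩

lemma isCompact_anchorTimes (hF : IsClosed F) (hγ : Continuous γ) :
    IsCompact (anchorTimes F γ) := by
  have : anchorTimes F γ = Icc 0 1 ∩ ({0} ∪ ({1} ∪ γ ⁻¹' F)) := by
    ext τ
    simp only [anchorTimes, mem_ofPred_eq, mem_inter_iff, mem_union, mem_singleton_iff,
      mem_preimage]
  rw [this]
  exact isCompact_Icc.inter_right
    (isClosed_singleton.union (isClosed_singleton.union (hF.preimage hγ)))

lemma isGreatest_prevAnchor (hF : IsClosed F) (hγ : Continuous γ) (τ : ℝ) :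
    IsGreatest (anchorTimes F γ ∩ Iic (max τ 0)) (prevAnchor F γ τ) :=
  ((isCompact_anchorTimes hF hγ).inter_right isClosed_Iic).isGreatest_sSup
    ⟨0, zero_mem_anchorTimes F γ, mem_Iic.2 (le_max_right _ _)⟩

lemma isLeast_nextAnchor (hF : IsClosed F) (hγ : Continuous γ) (τ : ℝ) :
    IsLeast (anchorTimes F γ ∩ Ici (min τ 1)) (nextAnchor F γ τ) :=
  ((isCompact_anchorTimes hF hγ).inter_right isClosed_Ici).isLeast_sInf
    ⟨1, one_mem_anchorTimes F γ, mem_Ici.2 (min_le_right _ _)⟩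

lemma prevAnchor_le (hF : IsClosed F) (hγ : Continuous γ) {τ : ℝ} (hτ : τ ∈ Icc (0 : ℝ) 1) :
    prevAnchor F γ τ ≤ τ := by
  simpa [hτ.1] using (isGreatest_prevAnchor hF hγ τ).1.2

lemma le_nextAnchor (hF : IsClosed F) (hγ : Continuous γ) {τ : ℝ} (hτ : τ ∈ Icc (0 : ℝ) 1) :
    τ ≤ nextAnchor F γ τ := by
  simpa [hτ.2] using (isLeast_nextAnchor hF hγ τ).1.2

lemma le_prevAnchor (hF : IsClosed F) (hγ : Continuous γ) {σ τ : ℝ}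
    (hσ : σ ∈ anchorTimes F γ) (h : σ ≤ τ) : σ ≤ prevAnchor F γ τ :=
  (isGreatest_prevAnchor hF hγ τ).2 ⟨hσ, h.trans (le_max_left _ _)⟩

lemma nextAnchor_le (hF : IsClosed F) (hγ : Continuous γ) {σ τ : ℝ}
    (hσ : σ ∈ anchorTimes F γ) (h : τ ≤ σ) : nextAnchor F γ τ ≤ σ :=
  (isLeast_nextAnchor hF hγ τ).2 ⟨hσ, (min_le_left _ _).trans h⟩

lemma notMem_anchorTimes_of_mem_Ioo (hF : IsClosed F) (hγ : Continuous γ) {σ τ : ℝ}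
    (hσ : σ ∈ Ioo (prevAnchor F γ τ) (nextAnchor F γ τ)) : σ ∉ anchorTimes F γ := by
  intro h
  rcases le_total σ τ with hle | hle
  · exact (le_prevAnchor hF hγ h hle).not_gt hσ.1
  · exact (nextAnchor_le hF hγ h hle).not_gt hσ.2

lemma anchor_eq_of_mem_Ioo (hF : IsClosed F) (hγ : Continuous γ) {σ τ : ℝ}
    (hσ : σ ∈ Ioo (prevAnchor F γ τ) (nextAnchor F γ τ)) :
    prevAnchor F γ σ = prevAnchor F γ τ ∧ nextAnchor F γ σ = nextAnchor F γ τ := by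
  have hp := (isGreatest_prevAnchor hF hγ τ).1.1
  have hn := (isLeast_nextAnchor hF hγ τ).1.1
  have hσI : σ ∈ Icc (0 : ℝ) 1 := ⟨hp.1.1.trans hσ.1.le, hσ.2.le.trans hn.1.2⟩
  constructor
  · refine le_antisymm ?_ (le_prevAnchor hF hγ hp hσ.1.le)
    by_contra! h
    exact notMem_anchorTimes_of_mem_Ioo hF hγ
      ⟨h, (prevAnchor_le hF hγ hσI).trans_lt hσ.2⟩ (isGreatest_prevAnchor hF hγ σ).1.1
  · refine le_antisymm (nextAnchor_le hF hγ hn hσ.2.le) ?_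
    by_contra! h
    exact notMem_anchorTimes_of_mem_Ioo hF hγ
      ⟨hσ.1.trans_le (le_nextAnchor hF hγ hσI), h⟩ (isLeast_nextAnchor hF hγ σ).1.1

lemma mem_Ioo_of_gapLength_pos (hF : IsClosed F) (hγ : Continuous γ) {τ : ℝ}
    (hτ : τ ∈ Icc (0 : ℝ) 1) (h : 0 < gapLength F γ τ) :
    τ ∈ Ioo (prevAnchor F γ τ) (nextAnchor F γ τ) := by
  have hno : τ ∉ anchorTimes F γ := fun hA => by
    have h1 := le_antisymm (prevAnchor_le hF hγ hτ) (le_prevAnchor hF hγ hA le_rfl)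
    have h2 := le_antisymm (nextAnchor_le hF hγ hA le_rfl) (le_nextAnchor hF hγ hτ)
    simp [gapLength, h1, h2] at h
  refine ⟨(prevAnchor_le hF hγ hτ).lt_of_ne fun heq => hno ?_,
    (le_nextAnchor hF hγ hτ).lt_of_ne fun heq => hno ?_⟩
  · rw [← heq]; exact (isGreatest_prevAnchor hF hγ τ).1.1
  · rw [heq]; exact (isLeast_nextAnchor hF hγ τ).1.1

lemma exists_isStraightOn_anchors (hF : IsClosed F) {x y : Euc d} (hγ : AdmissiblePath F x y γ)
    (τ : ℝ) : ∃ u : Euc d, ‖u‖ = 1 ∧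
      IsStraightOn γ u (prevAnchor F γ τ) (nextAnchor F γ τ) := by
  have hcont : Continuous γ := by obtain ⟨C, hC⟩ := hγ.1; exact hC.continuous
  have hp := (isGreatest_prevAnchor hF hcont τ).1.1.1
  have hn := (isLeast_nextAnchor hF hcont τ).1.1.1
  exact hγ.2.2.2 _ _ hp.1 hn.2 fun t ht htF => notMem_anchorTimes_of_mem_Ioo hF hcont ht
    ⟨⟨hp.1.trans ht.1.le, ht.2.le.trans hn.2⟩, Or.inr (Or.inr htF)⟩

end Anchors

/-- The image of the weighted length element as a measure on the time interval `[0, 1]`. -/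
def weightMeasure {d : ℕ} (g : Euc d → ℝ) (γ : ℝ → Euc d) : Measure ℝ :=
  (volume.restrict (Icc (0 : ℝ) 1)).withDensity fun τ => ENNReal.ofReal (g (γ τ) * ‖deriv γ τ‖)

lemma integrableOn_weight {d : ℕ} {g : Euc d → ℝ} (hg : Continuous g) {γ : ℝ → Euc d}
    (hγ : IsLipschitzPath γ) {s t : ℝ} (hst : s ≤ t) :
    IntegrableOn (fun τ => g (γ τ) * ‖deriv γ τ‖) (Icc s t) := by
  obtain ⟨C, hC⟩ := hγ
  exact (intervalIntegrable_iff_integrableOn_Icc_of_le hst).1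
    (intervalIntegrable_weightedLength hg hC s t)

lemma isFiniteMeasure_weightMeasure {d : ℕ} {g : Euc d → ℝ} (hg : Continuous g) {γ : ℝ → Euc d}
    (hγ : IsLipschitzPath γ) : IsFiniteMeasure (weightMeasure g γ) :=
  isFiniteMeasure_withDensity_ofReal (integrableOn_weight hg hγ zero_le_one).2

lemma weightMeasure_Icc {d : ℕ} {g : Euc d → ℝ} (hg : Continuous g) (hg0 : ∀ z, 0 ≤ g z)
    {γ : ℝ → Euc d} (hγ : IsLipschitzPath γ) {s t : ℝ} (hs : 0 ≤ s) (hst : s ≤ t) (ht : t ≤ 1) :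
    weightMeasure g γ (Icc s t) = ENNReal.ofReal (weightedLength g γ s t) := by
  rw [weightMeasure, withDensity_apply _ measurableSet_Icc,
    Measure.restrict_restrict measurableSet_Icc, inter_eq_left.2 (Icc_subset_Icc hs ht),
    ← ofReal_integral_eq_lintegral_ofReal (integrableOn_weight hg hγ hst)
      (Filter.Eventually.of_forall fun τ => mul_nonneg (hg0 _) (norm_nonneg _)),
    integral_Icc_eq_integral_Ioc, ← intervalIntegral.integral_of_le hst, weightedLength]

lemma weightMeasure_Ioo {d : ℕ} {g : Euc d → ℝ} (hg : Continuous g) (hg0 : ∀ z, 0 ≤ g z)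
    {γ : ℝ → Euc d} (hγ : IsLipschitzPath γ) {s t : ℝ} (hs : 0 ≤ s) (hst : s ≤ t) (ht : t ≤ 1) :
    weightMeasure g γ (Ioo s t) = ENNReal.ofReal (weightedLength g γ s t) := by
  rw [← weightMeasure_Icc hg hg0 hγ hs hst ht]
  refine measure_congr ?_
  exact (withDensity_absolutelyContinuous _ _).ae_le
    (ae_restrict_of_ae (Ioo_ae_eq_Icc (μ := volume)))

lemma weightMeasure_real_Icc {d : ℕ} {g : Euc d → ℝ} (hg : Continuous g) (hg0 : ∀ z, 0 ≤ g z)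
    {γ : ℝ → Euc d} (hγ : IsLipschitzPath γ) {s t : ℝ} (hs : 0 ≤ s) (hst : s ≤ t) (ht : t ≤ 1) :
    (weightMeasure g γ).real (Icc s t) = weightedLength g γ s t := by
  rw [measureReal_def, weightMeasure_Icc hg hg0 hγ hs hst ht,
    ENNReal.toReal_ofReal (weightedLength_nonneg hg0 γ hst)]

lemma mul_measureReal_le_of_mul_measure_le {μ ν : Measure ℝ} [IsFiniteMeasure ν] {S : Set ℝ}
    {c : ℝ} (hc : 0 ≤ c) (h : ENNReal.ofReal c * μ S ≤ ν S) : c * μ.real S ≤ ν.real S := by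
  have := ENNReal.toReal_mono (measure_ne_top ν S) h
  rwa [ENNReal.toReal_mul, ENNReal.toReal_ofReal hc] at this

lemma mul_weightMeasure_le {d : ℕ} {g : Euc d → ℝ} {γ : ℝ → Euc d} {S : Set ℝ}
    (hS : MeasurableSet S) {c : ℝ} (hc : 0 ≤ c) (h : ∀ τ ∈ S, c ≤ g (γ τ)) :
    ENNReal.ofReal c * weightMeasure (fun _ => 1) γ S ≤ weightMeasure g γ S := by
  rw [weightMeasure, weightMeasure, withDensity_apply _ hS, withDensity_apply _ hS,
    ← lintegral_const_mul' _ _ ENNReal.ofReal_ne_top]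
  refine setLIntegral_mono' hS fun τ hτ => ?_
  rw [← ENNReal.ofReal_mul hc, one_mul]
  exact ENNReal.ofReal_le_ofReal (mul_le_mul_of_nonneg_right (h τ hτ) (norm_nonneg _))

/-- Comparison of two measures gap by gap. -/
lemma mul_measure_le_of_gaps {d : ℕ} {F : Set (Euc d)} {γ : ℝ → Euc d} (hF : IsClosed F)
    (hγ : Continuous γ) {μ ν : Measure ℝ} {c : ℝ≥0∞} {T : Set ℝ} (hT : T ⊆ Icc 0 1)
    (hpos : ∀ τ ∈ T, 0 < gapLength F γ τ)
    (hsub : ∀ τ ∈ T, Ioo (prevAnchor F γ τ) (nextAnchor F γ τ) ⊆ T)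
    (h : ∀ τ ∈ T, c * μ (Ioo (prevAnchor F γ τ) (nextAnchor F γ τ)) ≤
      ν (Ioo (prevAnchor F γ τ) (nextAnchor F γ τ))) : c * μ T ≤ ν T := by
  set U : ℝ → Set ℝ := fun a => T ∩ prevAnchor F γ ⁻¹' {a} with hU
  have hmem : ∀ τ ∈ T, τ ∈ Ioo (prevAnchor F γ τ) (nextAnchor F γ τ) := fun τ hτ =>
    mem_Ioo_of_gapLength_pos hF hγ (hT hτ) (hpos τ hτ)
  have hUeq : ∀ τ ∈ T, U (prevAnchor F γ τ) = Ioo (prevAnchor F γ τ) (nextAnchor F γ τ) := by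
    intro τ hτ
    refine Subset.antisymm ?_ fun σ hσ => ⟨hsub τ hτ hσ, (anchor_eq_of_mem_Ioo hF hγ hσ).1⟩
    rintro σ ⟨hσT, hσ⟩
    have hσ' : prevAnchor F γ σ = prevAnchor F γ τ := hσ
    have h1 := hmem σ hσT
    refine ⟨hσ' ▸ h1.1, ?_⟩
    by_contra! hle
    have h2 := hmem τ hτ
    have h3 := le_prevAnchor hF hγ (isLeast_nextAnchor hF hγ τ).1.1 hle
    rw [hσ'] at h3
    linarith [h2.1, h2.2]
  have hdisj : (prevAnchor F γ '' T).PairwiseDisjoint U := by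
    intro a _ b _ hab
    refine disjoint_left.2 fun σ hσ hσ' => hab ?_
    exact (hσ.2 : prevAnchor F γ σ = a).symm.trans hσ'.2
  have hopen : ∀ a ∈ prevAnchor F γ '' T, IsOpen (U a) := by
    rintro _ ⟨τ, hτ, rfl⟩
    rw [hUeq τ hτ]
    exact isOpen_Ioo
  have hcount : (prevAnchor F γ '' T).Countable := by
    refine hdisj.countable_of_isOpen hopen ?_
    rintro _ ⟨τ, hτ, rfl⟩
    exact ⟨τ, hτ, rfl⟩
  have hTU : T = ⋃ a ∈ prevAnchor F γ '' T, U a := by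
    refine Subset.antisymm (fun τ hτ => mem_biUnion (mem_image_of_mem _ hτ) ⟨hτ, rfl⟩) ?_
    exact iUnion₂_subset fun a _ => inter_subset_left
  rw [hTU, measure_biUnion hcount hdisj fun a ha => (hopen a ha).measurableSet,
    measure_biUnion hcount hdisj fun a ha => (hopen a ha).measurableSet, ← ENNReal.tsum_mul_left]
  refine ENNReal.tsum_le_tsum ?_
  rintro ⟨_, τ, hτ, rfl⟩
  rw [hUeq τ hτ]
  exact h τ hτ

lemma weightedLength_one_eq_gapLength {d : ℕ} {F : Set (Euc d)} {x y : Euc d} {γ : ℝ → Euc d}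
    (hF : IsClosed F) (hγ : AdmissiblePath F x y γ) {τ : ℝ}
    (hle : prevAnchor F γ τ ≤ nextAnchor F γ τ) :
    weightedLength (fun _ => 1) γ (prevAnchor F γ τ) (nextAnchor F γ τ) = gapLength F γ τ := by
  obtain ⟨u, hu1, hu⟩ := exists_isStraightOn_anchors hF hγ τ
  rw [gapLength, hu.norm_sub hγ.1 hu1 le_rfl hle le_rfl]
  simp [weightedLength]

/-- The length spent at scale at least `r / 2` is controlled by the weighted length. -/
lemma measure_large_scale_le {d : ℕ} {m β : ℝ} (hm : m ∈ Ioo (0 : ℝ) 1) (hβ : 1 ≤ β)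
    {e : Euc d → ℝ} (he : LipschitzWith 1 e) (he0 : ∀ z, 0 ≤ e z) (hpack : HasPacking m e)
    {F : Set (Euc d)} (hF : IsClosed F) {x y : Euc d} {γ : ℝ → Euc d}
    (hγ : AdmissiblePath F x y γ) {r : ℝ} (hr : 0 < r) {s t : ℝ} (hst : s ≤ t)
    (hs : s ∈ anchorTimes F γ) (ht : t ∈ anchorTimes F γ) :
    (weightMeasure (fun _ => 1) γ).real
        {τ | τ ∈ Icc s t ∧ (r / 2 < e (γ τ) ∨ r / 2 < gapLength F γ τ)} ≤
      (1 + (36 / m) ^ (β + 1)) * (2 / r) ^ β * weightedLength (fun z => e z ^ β) γ s t := by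
  have hcont : Continuous γ := by obtain ⟨C, hC⟩ := hγ.1; exact hC.continuous
  have hg : Continuous fun z => e z ^ β := continuous_rpow_comp (by linarith) he.continuous
  have hg0 : ∀ z, 0 ≤ e z ^ β := fun z => Real.rpow_nonneg (he0 z) β
  have hfin := isFiniteMeasure_weightMeasure hg hγ.1
  have hfin1 := isFiniteMeasure_weightMeasure (g := fun _ => 1) continuous_const hγ.1
  have hm0 := hm.1
  set W := weightedLength (fun z => e z ^ β) γ s t
  set μ := weightMeasure (fun _ => 1) γ
  set ν := weightMeasure (fun z => e z ^ β) γ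
  have hν : ν.real (Icc s t) = W := weightMeasure_real_Icc hg hg0 hγ.1 hs.1.1 hst ht.1.2
  set T₁ : Set ℝ := {τ | τ ∈ Icc s t ∧ r / 2 < e (γ τ)}
  set T₂ : Set ℝ := {τ | τ ∈ Icc s t ∧ r / 2 < gapLength F γ τ}
  have hT₁ : MeasurableSet T₁ :=
    measurableSet_Icc.inter (measurableSet_lt measurable_const
      (he.continuous.comp hcont).measurable)
  have h1 : (r / 2) ^ β * μ.real T₁ ≤ W := by
    refine (mul_measureReal_le_of_mul_measure_le (ν := ν) (by positivity)
      (mul_weightMeasure_le hT₁ (by positivity) fun τ hτ => ?_)).trans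
      ((measureReal_mono fun τ hτ => hτ.1).trans hν.le)
    exact Real.rpow_le_rpow (by positivity) hτ.2.le (by linarith)
  have hI : Icc s t ⊆ Icc 0 1 := Icc_subset_Icc hs.1.1 ht.1.2
  have h2 : ((m / 36) ^ (β + 1) * (r / 2) ^ β) * μ.real T₂ ≤ W := by
    refine (mul_measureReal_le_of_mul_measure_le (ν := ν) (by positivity) ?_).trans
      ((measureReal_mono fun τ hτ => hτ.1).trans hν.le)
    have hpos : ∀ τ ∈ T₂, 0 < gapLength F γ τ := fun τ hτ => lt_trans (by positivity) hτ.2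
    refine mul_measure_le_of_gaps hF hcont (fun τ hτ => hI hτ.1) hpos ?_ ?_
    · intro τ hτ σ hσ
      obtain ⟨ha, hb⟩ := anchor_eq_of_mem_Ioo hF hcont hσ
      refine ⟨⟨(le_prevAnchor hF hcont hs hτ.1.1).trans hσ.1.le,
        hσ.2.le.trans (nextAnchor_le hF hcont ht hτ.1.2)⟩, ?_⟩
      rw [gapLength, ha, hb]
      exact hτ.2
    · intro τ hτ
      have hab : prevAnchor F γ τ ≤ nextAnchor F γ τ :=
        (prevAnchor_le hF hcont (hI hτ.1)).trans (le_nextAnchor hF hcont (hI hτ.1))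
      have ha := (isGreatest_prevAnchor hF hcont τ).1.1.1.1
      have hb := (isLeast_nextAnchor hF hcont τ).1.1.1.2
      rw [weightMeasure_Ioo hg hg0 hγ.1 ha hab hb,
        weightMeasure_Ioo continuous_const (fun _ => zero_le_one) hγ.1 ha hab hb,
        ← ENNReal.ofReal_mul (by positivity), weightedLength_one_eq_gapLength hF hγ hab]
      refine ENNReal.ofReal_le_ofReal ?_
      obtain ⟨u, hu1, hu⟩ := exists_isStraightOn_anchors hF hγ τ
      refine le_trans ?_ (rpow_le_weightedLength_of_isStraightOn hm hβ he he0 hpack hγ.1 hu1 hab hu)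
      change _ ≤ (m * gapLength F γ τ / 36) ^ (β + 1)
      have hL := hpos τ hτ
      rw [mul_div_right_comm, Real.mul_rpow (by positivity) hL.le, mul_assoc,
        Real.rpow_add_one hL.ne' β]
      have : (r / 2) ^ β ≤ gapLength F γ τ ^ β :=
        Real.rpow_le_rpow (by positivity) hτ.2.le (by linarith)
      gcongr
  have hunion : {τ | τ ∈ Icc s t ∧ (r / 2 < e (γ τ) ∨ r / 2 < gapLength F γ τ)} = T₁ ∪ T₂ := by
    ext τ
    exact and_or_left
  have hA : (0 : ℝ) < (r / 2) ^ β := by positivity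
  have hB : (0 : ℝ) < (m / 36) ^ (β + 1) := by positivity
  have e1 : (2 / r) ^ β = ((r / 2) ^ β)⁻¹ := by rw [← Real.inv_rpow (by positivity), inv_div]
  have e2 : (36 / m) ^ (β + 1) = ((m / 36) ^ (β + 1))⁻¹ := by
    rw [← Real.inv_rpow (by positivity), inv_div]
  have h1' : μ.real T₁ ≤ ((r / 2) ^ β)⁻¹ * W := (le_inv_mul_iff₀ hA).2 h1
  have h2' : μ.real T₂ ≤ ((m / 36) ^ (β + 1) * (r / 2) ^ β)⁻¹ * W :=
    (le_inv_mul_iff₀ (by positivity)).2 h2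
  rw [hunion, e1, e2]
  refine (measureReal_union_le _ _).trans ((add_le_add h1' h2').trans (le_of_eq ?_))
  rw [mul_inv]
  ring

/-- The times at which both the weight and the surrounding gap are at scale at most `r`. -/
def smallScale {d : ℕ} (e : Euc d → ℝ) (F : Set (Euc d)) (γ : ℝ → Euc d) (r : ℝ) : Set ℝ :=
  {τ | τ ∈ Icc (0 : ℝ) 1 ∧ e (γ τ) ≤ r ∧ gapLength F γ τ ≤ r}

lemma HasPacking.exists_net {d : ℕ} {m : ℝ} (hm : 0 < m) {e : Euc d → ℝ} (he : HasPacking m e)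
    {r : ℝ} (hr : 0 < r) {S : Set (Euc d)} (hS : ∀ z ∈ S, e z ≤ r) :
    ∃ Z : Finset (Euc d), ↑Z ⊆ S ∧ (Z.card : ℝ) * m ≤ 2 ∧
      ∀ z ∈ S, ∃ w ∈ Z, dist z w < 6 * r := by
  classical
  set N : Set ℕ := {n | ∃ Z : Finset (Euc d), Z.card = n ∧ ↑Z ⊆ S ∧
    ∀ z ∈ Z, ∀ w ∈ Z, z ≠ w → 6 * r ≤ dist z w} with hN
  have hcard : ∀ Z : Finset (Euc d), ↑Z ⊆ S → (∀ z ∈ Z, ∀ w ∈ Z, z ≠ w → 6 * r ≤ dist z w) →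
      (Z.card : ℝ) * m ≤ 2 := fun Z hZ hsep => he r hr Z (fun z hz => hS z (hZ hz)) hsep
  have hbdd : BddAbove N := by
    refine ⟨⌊2 / m⌋₊, ?_⟩
    rintro _ ⟨Z, rfl, hZ, hsep⟩
    exact Nat.le_floor ((le_div_iff₀ hm).2 (hcard Z hZ hsep))
  obtain ⟨Z, hZc, hZ, hsep⟩ := Nat.sSup_mem (s := N) ⟨0, ∅, by simp⟩ hbdd
  refine ⟨Z, hZ, hcard Z hZ hsep, fun z hz => ?_⟩
  by_contra! hfar
  have hzZ : z ∉ Z := fun h => by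
    have := hfar z h
    rw [dist_self] at this
    linarith
  have hmem : (insert z Z).card ∈ N := by
    refine ⟨_, rfl, ?_, ?_⟩
    · rw [Finset.coe_insert]
      exact insert_subset hz hZ
    · intro v hv w hw hvw
      rcases Finset.mem_insert.1 hv with hv' | hv' <;> rcases Finset.mem_insert.1 hw with hw' | hw'
      · exact absurd (hv'.trans hw'.symm) hvw
      · exact hv' ▸ hfar w hw'
      · rw [dist_comm]
        exact hw' ▸ hfar v hv'
      · exact hsep v hv' w hw' hvw
  have := le_csSup hbdd hmem
  rw [Finset.card_insert_of_notMem hzZ, hZc] at this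
  omega

/-- A nearly optimal path has small length at scale `r` near a point of small weight. -/
lemma measure_smallScale_near_le {d : ℕ} {m β : ℝ} (hm : m ∈ Ioo (0 : ℝ) 1) (hβ : 1 ≤ β)
    {e : Euc d → ℝ} (he : LipschitzWith 1 e) (he0 : ∀ z, 0 ≤ e z) (hpack : HasPacking m e)
    {F : Set (Euc d)} (hF : IsClosed F) {x y : Euc d} {γ : ℝ → Euc d}
    (hγ : AdmissiblePath F x y γ) {ε : ℝ} (hε : 0 ≤ ε)
    (hopt : ∀ γ', AdmissiblePath F x y γ' → weightedLength (fun z => e z ^ β) γ 0 1 ≤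
      weightedLength (fun z => e z ^ β) γ' 0 1 + ε)
    {r : ℝ} (hr : 0 < r) {z : Euc d} (hz : e z ≤ r) :
    (weightMeasure (fun _ => 1) γ).real
        ((smallScale e F γ r ∩ {τ | dist (γ τ) z < 6 * r}) \ smallScale e F γ (r / 2)) ≤
      (1 + (36 / m) ^ (β + 1)) * (2 / r) ^ β * ((8 * r) ^ β * (14 * r) + ε) := by
  have hcont : Continuous γ := by obtain ⟨C, hC⟩ := hγ.1; exact hC.continuous
  have hm0 := hm.1
  have hg : Continuous fun z => e z ^ β := continuous_rpow_comp (by linarith) he.continuous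
  have hfin1 := isFiniteMeasure_weightMeasure (g := fun _ => 1) continuous_const hγ.1
  set S : Set ℝ := anchorTimes F γ ∩ {σ | dist (γ σ) z ≤ 7 * r}
  have hSc : IsCompact S := (isCompact_anchorTimes hF hcont).inter_right
    (isClosed_le (by fun_prop) continuous_const)
  have hanchor : ∀ τ ∈ smallScale e F γ r ∩ {τ | dist (γ τ) z < 6 * r},
      prevAnchor F γ τ ∈ S ∧ nextAnchor F γ τ ∈ S := by
    rintro τ ⟨⟨hτ, -, hgap⟩, hd⟩
    have hd' : dist (γ τ) z < 6 * r := hd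
    obtain ⟨u, hu1, hu⟩ := exists_isStraightOn_anchors hF hγ τ
    have h1 := hu.norm_sub_add hγ.1 hu1 (prevAnchor_le hF hcont hτ) (le_nextAnchor hF hcont hτ)
      le_rfl
    rw [gapLength] at hgap
    have h2 := norm_nonneg (γ τ - γ (prevAnchor F γ τ))
    have h3 := norm_nonneg (γ (nextAnchor F γ τ) - γ τ)
    refine ⟨⟨(isGreatest_prevAnchor hF hcont τ).1.1, ?_⟩,
      ⟨(isLeast_nextAnchor hF hcont τ).1.1, ?_⟩⟩
    · have h4 := dist_triangle_left (γ (prevAnchor F γ τ)) z (γ τ)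
      rw [dist_eq_norm (γ τ) (γ _)] at h4
      change dist _ _ ≤ _
      linarith
    · have h4 := dist_triangle (γ (nextAnchor F γ τ)) (γ τ) z
      rw [dist_eq_norm _ (γ τ)] at h4
      change dist _ _ ≤ _
      linarith
  rcases S.eq_empty_or_nonempty with hS | hS
  · have hemp : smallScale e F γ r ∩ {τ | dist (γ τ) z < 6 * r} = ∅ := by
      refine eq_empty_of_forall_notMem fun τ hτ => ?_
      have := (hanchor τ hτ).1
      rw [hS] at this
      exact this
    rw [hemp, empty_sdiff, measureReal_empty]
    positivity
  · obtain ⟨s, hs⟩ := hSc.exists_isLeast hS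
    obtain ⟨t, ht⟩ := hSc.exists_isGreatest hS
    have hst : s ≤ t := hs.2 ht.1
    have hWle : weightedLength (fun z => e z ^ β) γ s t ≤ (8 * r) ^ β * (14 * r) + ε := by
      refine (weightedLength_le_of_nearly_optimal hγ hg hε hopt hst hs.1.1 ht.1.1
        (M := (8 * r) ^ β) fun w hw => ?_).trans ?_
      · have hw' : w ∈ closedBall z (7 * r) :=
          (convex_closedBall z (7 * r)).segment_subset hs.1.2 ht.1.2 hw
        have h1 := he.dist_le_mul w z
        rw [NNReal.coe_one, one_mul, Real.dist_eq] at h1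
        have h2 := (le_abs_self _).trans h1
        exact Real.rpow_le_rpow (he0 w) (by linarith [mem_closedBall.1 hw']) (by linarith)
      · gcongr
        have h1 : dist (γ s) z ≤ 7 * r := hs.1.2
        have h2 : dist (γ t) z ≤ 7 * r := ht.1.2
        rw [← dist_eq_norm]
        linarith [dist_triangle_right (γ t) (γ s) z]
    refine (measureReal_mono (fun τ hτ => ?_)).trans
      ((measure_large_scale_le hm hβ he he0 hpack hF hγ hr hst hs.1.1 ht.1.1).trans ?_)
    · obtain ⟨hτ1, hτ2⟩ := hτ
      obtain ⟨h1, h2⟩ := hanchor τ hτ1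
      have hτ01 := hτ1.1.1
      refine ⟨⟨(hs.2 h1).trans (prevAnchor_le hF hcont hτ01),
        (le_nextAnchor hF hcont hτ01).trans (ht.2 h2)⟩, ?_⟩
      by_contra! hcon
      exact hτ2 ⟨hτ01, hcon⟩
    · gcongr

lemma measure_smallScale_le_half {d : ℕ} {m β : ℝ} (hm : m ∈ Ioo (0 : ℝ) 1) (hβ : 1 ≤ β)
    {e : Euc d → ℝ} (he : LipschitzWith 1 e) (he0 : ∀ z, 0 ≤ e z) (hpack : HasPacking m e)
    {F : Set (Euc d)} (hF : IsClosed F) {x y : Euc d} {γ : ℝ → Euc d}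
    (hγ : AdmissiblePath F x y γ) {ε : ℝ} (hε : 0 ≤ ε)
    (hopt : ∀ γ', AdmissiblePath F x y γ' → weightedLength (fun z => e z ^ β) γ 0 1 ≤
      weightedLength (fun z => e z ^ β) γ' 0 1 + ε)
    {r : ℝ} (hr : 0 < r) :
    (weightMeasure (fun _ => 1) γ).real (smallScale e F γ r) ≤
      (weightMeasure (fun _ => 1) γ).real (smallScale e F γ (r / 2)) +
        2 / m * ((1 + (36 / m) ^ (β + 1)) * (2 / r) ^ β * ((8 * r) ^ β * (14 * r) + ε)) := by
  have hm0 := hm.1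
  have hfin1 := isFiniteMeasure_weightMeasure (g := fun _ => 1) continuous_const hγ.1
  obtain ⟨Z, hZ, hcard, hnet⟩ := hpack.exists_net hm0 hr
    (S := γ '' smallScale e F γ r) (by rintro _ ⟨τ, hτ, rfl⟩; exact hτ.2.1)
  set μ := weightMeasure (fun _ => 1) γ
  set B := (1 + (36 / m) ^ (β + 1)) * (2 / r) ^ β * ((8 * r) ^ β * (14 * r) + ε)
  set P : Euc d → Set ℝ := fun z =>
    (smallScale e F γ r ∩ {τ | dist (γ τ) z < 6 * r}) \ smallScale e F γ (r / 2)
  have hcover : smallScale e F γ r ⊆ smallScale e F γ (r / 2) ∪ ⋃ z ∈ Z, P z := by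
    intro τ hτ
    by_cases h : τ ∈ smallScale e F γ (r / 2)
    · exact Or.inl h
    · obtain ⟨z, hz, hd⟩ := hnet _ (mem_image_of_mem γ hτ)
      exact Or.inr (mem_biUnion hz ⟨⟨hτ, hd⟩, h⟩)
  refine (measureReal_mono hcover).trans ((measureReal_union_le _ _).trans ?_)
  gcongr
  calc μ.real (⋃ z ∈ Z, P z) ≤ ∑ z ∈ Z, μ.real (P z) := measureReal_biUnion_finset_le _ _
    _ ≤ ∑ _z ∈ Z, B := Finset.sum_le_sum fun z hz =>
        measure_smallScale_near_le hm hβ he he0 hpack hF hγ hε hopt hr (by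
          obtain ⟨τ, hτ, rfl⟩ := hZ hz
          exact hτ.2.1)
    _ = Z.card * B := by rw [Finset.sum_const, nsmul_eq_mul]
    _ ≤ 2 / m * B := by
        refine mul_le_mul_of_nonneg_right ((le_div_iff₀ hm0).2 hcard) ?_
        positivity

/-- The constant bounding the length of nearly optimal paths by their largest scale. -/
def scaleConst (m β : ℝ) : ℝ := 2 / m * (1 + (36 / m) ^ (β + 1))

lemma scaleConst_pos {m β : ℝ} (hm : 0 < m) : 0 < scaleConst m β := by
  rw [scaleConst]
  positivity

lemma measure_smallScale_le {d : ℕ} {m β : ℝ} (hm : m ∈ Ioo (0 : ℝ) 1) (hβ : 1 ≤ β)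
    {e : Euc d → ℝ} (he : LipschitzWith 1 e) {η : ℝ} (hη : 0 < η) (heη : ∀ z, η ≤ e z)
    (hpack : HasPacking m e)
    {F : Set (Euc d)} (hF : IsClosed F) {x y : Euc d} {γ : ℝ → Euc d}
    (hγ : AdmissiblePath F x y γ) {ε : ℝ} (hε : 0 ≤ ε)
    (hopt : ∀ γ', AdmissiblePath F x y γ' → weightedLength (fun z => e z ^ β) γ 0 1 ≤
      weightedLength (fun z => e z ^ β) γ' 0 1 + ε) (n : ℕ) {r : ℝ} (hr : 0 < r)
    (hn : r / 2 ^ n < η) :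
    (weightMeasure (fun _ => 1) γ).real (smallScale e F γ r) ≤
      2 * (scaleConst m β * (14 * 16 ^ β)) * r + n * (scaleConst m β * (2 / η) ^ β * ε) := by
  have hm0 := hm.1
  have hA : 0 < scaleConst m β := scaleConst_pos hm0
  have hempty : ∀ r < η, smallScale e F γ r = ∅ := fun r hr =>
    eq_empty_of_forall_notMem fun τ hτ => absurd (hτ.2.1.trans_lt hr) (heη _).not_gt
  induction n generalizing r with
  | zero =>
    rw [hempty r (by simpa using hn), measureReal_empty]
    positivity
  | succ n ih =>
    rcases lt_or_ge r η with h | h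
    · rw [hempty r h, measureReal_empty]
      positivity
    · have h1 := measure_smallScale_le_half hm hβ he (fun z => hη.le.trans (heη z)) hpack hF hγ hε
        hopt hr
      have h2 := ih (half_pos hr) (by rwa [div_div, ← pow_succ'])
      have h3 : (2 / r) ^ β * (8 * r) ^ β = 16 ^ β := by
        rw [← Real.mul_rpow (by positivity) (by positivity)]
        congr 1
        field_simp
        norm_num
      have h4 : (2 / r) ^ β ≤ (2 / η) ^ β := by gcongr
      have h5 : 2 / m * ((1 + (36 / m) ^ (β + 1)) * (2 / r) ^ β * ((8 * r) ^ β * (14 * r) + ε)) =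
          scaleConst m β * ((2 / r) ^ β * (8 * r) ^ β * (14 * r)) +
            scaleConst m β * (2 / r) ^ β * ε := by
        rw [scaleConst]
        ring
      have h6 : scaleConst m β * (2 / r) ^ β * ε ≤ scaleConst m β * (2 / η) ^ β * ε := by gcongr
      rw [h5, h3] at h1
      push_cast
      linarith

/-- The length of a nearly optimal path is controlled by its largest scale. -/
lemma length_le_of_nearly_optimal {d : ℕ} {m β : ℝ} (hm : m ∈ Ioo (0 : ℝ) 1) (hβ : 1 ≤ β)
    {e : Euc d → ℝ} (he : LipschitzWith 1 e) {η : ℝ} (hη : 0 < η) (heη : ∀ z, η ≤ e z)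
    (hpack : HasPacking m e)
    {F : Set (Euc d)} (hF : IsClosed F) {x y : Euc d} {γ : ℝ → Euc d}
    (hγ : AdmissiblePath F x y γ) {ε : ℝ} (hε : 0 ≤ ε)
    (hopt : ∀ γ', AdmissiblePath F x y γ' → weightedLength (fun z => e z ^ β) γ 0 1 ≤
      weightedLength (fun z => e z ^ β) γ' 0 1 + ε) (n : ℕ) {r : ℝ} (hr : 0 < r)
    (hn : r / 2 ^ n < η) (hle : ∀ τ ∈ Icc (0 : ℝ) 1, e (γ τ) ≤ r ∧ gapLength F γ τ ≤ r) :
    weightedLength (fun _ => 1) γ 0 1 ≤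
      2 * (scaleConst m β * (14 * 16 ^ β)) * r + n * (scaleConst m β * (2 / η) ^ β * ε) := by
  rw [← weightMeasure_real_Icc continuous_const (fun _ => zero_le_one) hγ.1 le_rfl zero_le_one
    le_rfl]
  have hfin1 := isFiniteMeasure_weightMeasure (g := fun _ => 1) continuous_const hγ.1
  have hsub : Icc (0 : ℝ) 1 ⊆ smallScale e F γ r := fun τ hτ => ⟨hτ, hle τ hτ⟩
  exact (measureReal_mono hsub).trans
    (measure_smallScale_le hm hβ he hη heη hpack hF hγ hε hopt n hr hn)

lemma AdmissiblePath.map_anchorTimes_mem {d : ℕ} {K F : Set (Euc d)} (hFK : F ⊆ K) {x y : Euc d}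
    (hx : x ∈ K) (hy : y ∈ K) {γ : ℝ → Euc d} (hγ : AdmissiblePath F x y γ) {τ : ℝ}
    (hτ : τ ∈ anchorTimes F γ) : γ τ ∈ K := by
  rcases hτ.2 with rfl | rfl | h
  · rwa [hγ.2.1]
  · rwa [hγ.2.2.1]
  · exact hFK h

lemma AdmissiblePath.mem_of_convex {d : ℕ} {K F : Set (Euc d)} (hK : Convex ℝ K) (hFK : F ⊆ K)
    (hF : IsClosed F) {x y : Euc d} (hx : x ∈ K) (hy : y ∈ K) {γ : ℝ → Euc d}
    (hγ : AdmissiblePath F x y γ) {τ : ℝ} (hτ : τ ∈ Icc (0 : ℝ) 1) : γ τ ∈ K := by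
  have hcont : Continuous γ := by obtain ⟨C, hC⟩ := hγ.1; exact hC.continuous
  obtain ⟨u, hu1, hu⟩ := exists_isStraightOn_anchors hF hγ τ
  refine hK.segment_subset ?_ ?_
    (hu.mem_segment hγ.1 hu1 (prevAnchor_le hF hcont hτ) (le_nextAnchor hF hcont hτ))
  · exact hγ.map_anchorTimes_mem hFK hx hy (isGreatest_prevAnchor hF hcont τ).1.1
  · exact hγ.map_anchorTimes_mem hFK hx hy (isLeast_nextAnchor hF hcont τ).1.1

lemma two_mul_scaleConst_le_fdtmConst {m β : ℝ} (hm : m ∈ Ioo (0 : ℝ) 1) (hβ : 1 ≤ β) :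
    2 * (scaleConst m β * (14 * 16 ^ β)) ≤ fdtmConst m β := by
  obtain ⟨hm0, hm1⟩ := hm
  have hX : 0 < m ^ β := by positivity
  have h576 : (0 : ℝ) < 576 ^ β := by positivity
  have h1 : (1 : ℝ) ≤ (36 / m) ^ (β + 1) :=
    Real.one_le_rpow ((one_le_div hm0).2 (by linarith)) (by linarith)
  have h2 : (36 / m) ^ (β + 1) = 36 ^ β / m ^ β * (36 / m) := by
    rw [Real.rpow_add (by positivity), Real.rpow_one, Real.div_rpow (by norm_num) hm0.le]
  have h3 : (16 : ℝ) ^ β * 36 ^ β = 576 ^ β := by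
    rw [← Real.mul_rpow (by norm_num) (by norm_num)]
    norm_num
  have h4 : (165 : ℝ) ^ β * 32 ^ β = 5280 ^ β := by
    rw [← Real.mul_rpow (by norm_num) (by norm_num)]
    norm_num
  have h5 : 9 * (576 : ℝ) ^ β ≤ 5280 ^ β := by
    calc 9 * (576 : ℝ) ^ β ≤ 9 ^ β * 576 ^ β := by
          gcongr
          exact Real.self_le_rpow_of_one_le (by norm_num) hβ
      _ = 5184 ^ β := by
          rw [← Real.mul_rpow (by norm_num) (by norm_num)]
          norm_num
      _ ≤ 5280 ^ β := by
          gcongr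
          norm_num
  have h6 : (32 : ℝ) ^ β * (32 / m) ≤ (1 + 32 / m) ^ (β + 1) := by
    have h : 32 ≤ 1 + 32 / m := by
      have : 32 ≤ 32 / m := (le_div_iff₀ hm0).2 (by linarith)
      linarith
    rw [Real.rpow_add (by positivity), Real.rpow_one]
    gcongr
    linarith
  have hm2 : m ^ (2 + β) = m ^ 2 * m ^ β := by
    rw [Real.rpow_add hm0, Real.rpow_two]
  calc 2 * (scaleConst m β * (14 * 16 ^ β))
      ≤ 2 * (2 / m * ((36 / m) ^ (β + 1) + (36 / m) ^ (β + 1)) * (14 * 16 ^ β)) := by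
        rw [scaleConst]
        gcongr
    _ = 4032 * 576 ^ β / m ^ (2 + β) := by
        rw [h2, hm2, ← h3]
        field_simp
        norm_num
    _ ≤ 2304 * 5280 ^ β / m ^ (2 + β) := by
        gcongr ?_ / _
        linarith
    _ = 2 * (1152 * 165 ^ β / m ^ (2 + β)) * (32 ^ β * (32 / m)) / (32 / m) := by
        rw [← h4]
        field_simp
        norm_num
    _ ≤ fdtmConst m β := by
        rw [fdtmConst, add_sub_cancel_left]
        gcongr
        have : (0 : ℝ) < 16 * 5 ^ β := by positivity
        linarith

lemma weightedLength_mono {d : ℕ} {g h : Euc d → ℝ} (hg : Continuous g) (hh : Continuous h)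
    {γ : ℝ → Euc d} (hγ : IsLipschitzPath γ) (hgh : ∀ τ ∈ Icc (0 : ℝ) 1, g (γ τ) ≤ h (γ τ)) :
    weightedLength g γ 0 1 ≤ weightedLength h γ 0 1 := by
  obtain ⟨C, hC⟩ := hγ
  exact intervalIntegral.integral_mono_on zero_le_one (intervalIntegrable_weightedLength hg hC 0 1)
    (intervalIntegrable_weightedLength hh hC 0 1) fun τ hτ =>
      mul_le_mul_of_nonneg_right (hgh τ hτ) (norm_nonneg _)

lemma tendsto_weightedLength_add_rpow {d : ℕ} {β : ℝ} (hβ : 1 ≤ β) {g : Euc d → ℝ}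
    (hg : Continuous g) (hg0 : ∀ z, 0 ≤ g z) {γ : ℝ → Euc d} (hγ : IsLipschitzPath γ) {D : ℝ}
    (hD : ∀ τ ∈ Icc (0 : ℝ) 1, g (γ τ) ≤ D) :
    Filter.Tendsto (fun η => weightedLength (fun z => (g z + η) ^ β) γ 0 1) (nhdsWithin 0 (Ioi 0))
      (nhds (weightedLength (fun z => g z ^ β) γ 0 1)) := by
  obtain ⟨C, hC⟩ := hγ
  have hβ0 : 0 ≤ β := by linarith
  refine intervalIntegral.tendsto_integral_filter_of_dominated_convergence
    (fun τ => (D + 1) ^ β * ‖deriv γ τ‖) ?_ ?_ ((intervalIntegrable_speed hC 0 1).const_mul _) ?_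
  · refine Filter.Eventually.of_forall fun η => ?_
    exact (intervalIntegrable_iff.1 (intervalIntegrable_weightedLength
      (continuous_rpow_comp hβ0 (hg.add_const η)) hC 0 1)).aestronglyMeasurable
  · have h1 : ∀ᶠ η : ℝ in nhdsWithin 0 (Ioi 0), η < 1 :=
      nhdsWithin_le_nhds (Iio_mem_nhds zero_lt_one)
    filter_upwards [self_mem_nhdsWithin, h1] with η hη hη1
    refine Filter.Eventually.of_forall fun τ hτ => ?_
    rw [uIoc_of_le zero_le_one] at hτ
    have hη0 : 0 < η := hη
    have h2 := hg0 (γ τ)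
    have h3 := hD τ (Ioc_subset_Icc_self hτ)
    rw [Real.norm_of_nonneg (by positivity)]
    gcongr
  · refine Filter.Eventually.of_forall fun τ _ => Filter.Tendsto.mul_const _ ?_
    have : Continuous fun η : ℝ => (g (γ τ) + η) ^ β :=
      (continuous_const.add continuous_id).rpow_const fun _ => Or.inr hβ0
    simpa using (this.tendsto 0).mono_left nhdsWithin_le_nhds

lemma exists_nearly_optimal {d : ℕ} {F : Set (Euc d)} {x y : Euc d} {g : Euc d → ℝ}
    (hg0 : ∀ z, 0 ≤ g z) (hne : ∃ γ, AdmissiblePath F x y γ) {ε : ℝ} (hε : 0 < ε) :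
    ∃ γ, AdmissiblePath F x y γ ∧ ∀ γ', AdmissiblePath F x y γ' →
      weightedLength g γ 0 1 ≤ weightedLength g γ' 0 1 + ε := by
  set S : Set ℝ := {L | ∃ γ, AdmissiblePath F x y γ ∧ L = weightedLength g γ 0 1}
  have hS : S.Nonempty := by
    obtain ⟨γ, hγ⟩ := hne
    exact ⟨_, γ, hγ, rfl⟩
  have hbdd : BddBelow S := by
    refine ⟨0, ?_⟩
    rintro _ ⟨γ, -, rfl⟩
    exact weightedLength_nonneg hg0 γ zero_le_one
  obtain ⟨_, ⟨γ, hγ, rfl⟩, h⟩ := exists_lt_of_csInf_lt hS (lt_add_of_pos_right (sInf S) hε)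
  refine ⟨γ, hγ, fun γ' hγ' => h.le.trans ?_⟩
  gcongr
  exact csInf_le hbdd ⟨γ', hγ', rfl⟩

lemma fdtm_le_fdtmLength {d : ℕ} {m p β : ℝ} (hm : 0 < m) (μ : Measure (Euc d))
    {F : Set (Euc d)} {x y : Euc d} {γ : ℝ → Euc d} (hγ : AdmissiblePath F x y γ) :
    fdtm m p β μ F x y ≤ fdtmLength m p β μ γ := by
  refine csInf_le ⟨0, ?_⟩ ⟨γ, hγ, rfl⟩
  rintro _ ⟨γ', -, rfl⟩
  rw [fdtmLength_eq_weightedLength]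
  exact weightedLength_nonneg (fun z => Real.rpow_nonneg (dtm_nonneg hm p μ z) β) γ' zero_le_one

/-- Near-minimizers of the length can be chosen of controlled Euclidean length. -/
lemma exists_fdtmLength_le {d : ℕ} {m p β : ℝ} (hm : m ∈ Ioo (0 : ℝ) 1) (hp : 1 ≤ p)
    (hβ : 1 ≤ β) {K : Set (Euc d)} (hKc : IsCompact K) (hKconv : Convex ℝ K)
    (μ : Measure (Euc d)) [IsProbabilityMeasure μ] (hμ : measSupport μ ⊆ K)
    {F : Set (Euc d)} (hFK : F ⊆ K) (hF : IsClosed F) {x y : Euc d} (hx : x ∈ K) (hy : y ∈ K)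
    (hne : ∃ γ, AdmissiblePath F x y γ) {δ : ℝ} (hδ : 0 < δ) :
    ∃ γ, AdmissiblePath F x y γ ∧ fdtmLength m p β μ γ ≤ fdtm m p β μ F x y + 2 * δ ∧
      weightedLength (fun _ => 1) γ 0 1 ≤ fdtmConst m β * diam K + 2 * δ := by
  have hm0 := hm.1
  have hβ0 : 0 ≤ β := by linarith
  have hcont : Continuous (dtm m p μ) := (lipschitzWith_dtm hm hp μ).continuous
  have hnn : ∀ z, 0 ≤ dtm m p μ z := dtm_nonneg hm0 p μ
  have hdK : ∀ γ, AdmissiblePath F x y γ → ∀ τ ∈ Icc (0 : ℝ) 1, dtm m p μ (γ τ) ≤ diam K :=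
    fun γ hγ τ hτ => dtm_le_diam hm hp hKc μ hμ (hγ.mem_of_convex hKconv hFK hF hx hy hτ)
  set A := 2 * (scaleConst m β * (14 * 16 ^ β))
  obtain ⟨_, ⟨γ₀, hγ₀, rfl⟩, h₀⟩ := exists_lt_of_csInf_lt
    (s := {L : ℝ | ∃ γ : ℝ → Euc d, AdmissiblePath F x y γ ∧ L = fdtmLength m p β μ γ})
    (by obtain ⟨γ, hγ⟩ := hne; exact ⟨_, γ, hγ, rfl⟩)
    (lt_add_of_pos_right (fdtm m p β μ F x y) hδ)
  rw [fdtmLength_eq_weightedLength] at h₀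
  have h1 := (tendsto_weightedLength_add_rpow hβ hcont hnn hγ₀.1 (hdK γ₀ hγ₀)).eventually_lt_const
    h₀
  have h2 : ∀ᶠ η : ℝ in nhdsWithin 0 (Ioi 0), A * (diam K + η) < A * diam K + δ := by
    have hc : Continuous fun η : ℝ => A * (diam K + η) := by fun_prop
    refine ((hc.tendsto 0).mono_left nhdsWithin_le_nhds).eventually_lt_const ?_
    rw [add_zero]
    linarith
  obtain ⟨η, hη1, hη2, hη⟩ := (h1.and (h2.and self_mem_nhdsWithin)).exists
  have hη0 : 0 < η := hη
  have hD : 0 < diam K + η := add_pos_of_nonneg_of_pos diam_nonneg hη0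
  obtain ⟨n, hn⟩ := exists_nat_gt ((diam K + η) / η)
  have hn' : (diam K + η) / 2 ^ n < η := by
    rw [div_lt_iff₀ (by positivity)]
    rw [div_lt_iff₀ hη0] at hn
    have : (n : ℝ) ≤ 2 ^ n := by exact_mod_cast Nat.lt_two_pow_self.le
    nlinarith
  set B := scaleConst m β * (2 / η) ^ β
  have hB : 0 ≤ B := mul_nonneg (scaleConst_pos hm0).le (by positivity)
  have hε : 0 < δ / (1 + n * B) := by positivity
  set ε := δ / (1 + n * B) with hε_def
  have hεδ : ε + n * (B * ε) = δ := by
    rw [hε_def]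
    field_simp
  have hnB : 0 ≤ n * (B * ε) := by positivity
  set e : Euc d → ℝ := fun z => dtm m p μ z + η
  have heη : ∀ z, η ≤ e z := fun z => le_add_of_nonneg_left (hnn z)
  have he : LipschitzWith 1 e := LipschitzWith.of_dist_le_mul fun z w => by
    simpa [e] using (lipschitzWith_dtm hm hp μ).dist_le_mul z w
  have hpack : HasPacking m e := fun r hr Z hZ hsep =>
    card_mul_le_two_of_dtm_le hm hp μ hr Z (fun z hz => by linarith [hZ z hz, heη z]) hsep
  obtain ⟨γ, hγ, hopt⟩ := exists_nearly_optimal (g := fun z => e z ^ β)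
    (fun z => Real.rpow_nonneg (hη0.le.trans (heη z)) β) hne hε
  have hγcont : Continuous γ := by obtain ⟨C, hC⟩ := hγ.1; exact hC.continuous
  refine ⟨γ, hγ, ?_, ?_⟩
  · have h3 : fdtmLength m p β μ γ ≤ weightedLength (fun z => e z ^ β) γ 0 1 := by
      rw [fdtmLength_eq_weightedLength]
      exact weightedLength_mono (continuous_rpow_comp hβ0 hcont)
        (continuous_rpow_comp hβ0 he.continuous) hγ.1 fun τ _ =>
          Real.rpow_le_rpow (hnn _) (le_add_of_nonneg_right hη0.le) hβ0
    have h4 := hopt γ₀ hγ₀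
    linarith
  · have h3 := length_le_of_nearly_optimal hm hβ he hη0 heη hpack hF hγ hε.le hopt n hD hn'
      fun τ hτ => ⟨by linarith [hdK γ hγ τ hτ], ?_⟩
    · have h4 : A * diam K ≤ fdtmConst m β * diam K :=
        mul_le_mul_of_nonneg_right (two_mul_scaleConst_le_fdtmConst hm hβ) diam_nonneg
      linarith
    · have h5 := dist_le_diam_of_mem hKc.isBounded
        (hγ.map_anchorTimes_mem hFK hx hy (isLeast_nextAnchor hF hγcont τ).1.1)
        (hγ.map_anchorTimes_mem hFK hx hy (isGreatest_prevAnchor hF hγcont τ).1.1)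
      rw [gapLength, ← dist_eq_norm]
      linarith

/-- One-sided stability of the Fermat distance under a uniform bound on the weights. -/
lemma fdtm_sub_le {d : ℕ} {m p β : ℝ} (hm : m ∈ Ioo (0 : ℝ) 1) (hp : 1 ≤ p)
    (hβ : 1 ≤ β) {K : Set (Euc d)} (hKc : IsCompact K) (hKconv : Convex ℝ K)
    (μ ν : Measure (Euc d)) [IsProbabilityMeasure μ] [IsProbabilityMeasure ν]
    (hν : measSupport ν ⊆ K)
    {F : Set (Euc d)} (hFK : F ⊆ K) (hF : IsClosed F) {x y : Euc d} (hx : x ∈ K) (hy : y ∈ K)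
    (hne : ∃ γ, AdmissiblePath F x y γ) {S : ℝ} (hS0 : 0 ≤ S)
    (hS : ∀ z ∈ K, |dtm m p μ z ^ β - dtm m p ν z ^ β| ≤ S) :
    fdtm m p β μ F x y - fdtm m p β ν F x y ≤ fdtmConst m β * diam K * S := by
  have hβ0 : 0 ≤ β := by linarith
  refine le_of_forall_pos_le_add fun δ hδ => ?_
  have hδ' : 0 < δ / (2 + 2 * S) := by positivity
  obtain ⟨γ, hγ, h1, h2⟩ :=
    exists_fdtmLength_le hm hp hβ hKc hKconv ν hν hFK hF hx hy hne hδ'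
  have hcμ := continuous_rpow_comp hβ0 (lipschitzWith_dtm hm hp μ).continuous
  have hcν := continuous_rpow_comp hβ0 (lipschitzWith_dtm hm hp ν).continuous
  have h3 : fdtmLength m p β μ γ ≤
      fdtmLength m p β ν γ + S * weightedLength (fun _ => 1) γ 0 1 := by
    rw [fdtmLength_eq_weightedLength, fdtmLength_eq_weightedLength]
    have h4 : weightedLength (fun z => dtm m p ν z ^ β + S) γ 0 1 =
        weightedLength (fun z => dtm m p ν z ^ β) γ 0 1 +
          S * weightedLength (fun _ => 1) γ 0 1 := by
      obtain ⟨C, hC⟩ := hγ.1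
      simp only [weightedLength, one_mul, add_mul]
      rw [intervalIntegral.integral_add (intervalIntegrable_weightedLength hcν hC 0 1)
        ((intervalIntegrable_speed hC 0 1).const_mul S), intervalIntegral.integral_const_mul]
    rw [← h4]
    refine weightedLength_mono hcμ (hcν.add_const S) hγ.1 fun τ hτ => ?_
    have := (le_abs_self _).trans (hS _ (hγ.mem_of_convex hKconv hFK hF hx hy hτ))
    linarith
  have h5 := fdtm_le_fdtmLength (p := p) (β := β) hm.1 μ hγ
  have h6 := mul_le_mul_of_nonneg_left h2 hS0
  have h7 : 2 * (δ / (2 + 2 * S)) + S * (2 * (δ / (2 + 2 * S))) = δ := by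
    field_simp
  linarith

theorem fdtm_stability_measure {d : ℕ} (m p β : ℝ) (hm : m ∈ Set.Ioo (0 : ℝ) 1) (hp : 1 ≤ p)
    (hβ : 1 ≤ β) (K : Set (Euc d)) (hKc : IsCompact K) (hKconv : Convex ℝ K)
    (μ ν : Measure (Euc d)) [IsProbabilityMeasure μ] [IsProbabilityMeasure ν]
    (hμsupp : measSupport μ ⊆ K) (hνsupp : measSupport ν ⊆ K)
    (F : Set (Euc d)) (hFK : F ⊆ K) (hF : IsClosed F) (hFne : F.Nonempty)
    (x y : Euc d) (hx : x ∈ K) (hy : y ∈ K) :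
    |fdtm m p β μ F x y - fdtm m p β ν F x y| ≤
      fdtmConst m β * diam K * (⨆ z ∈ K, |dtm m p μ z ^ β - dtm m p ν z ^ β|) := by
  have hm0 := hm.1
  set S := ⨆ z ∈ K, |dtm m p μ z ^ β - dtm m p ν z ^ β|
  have hS0 : 0 ≤ S := Real.iSup_nonneg fun z => Real.iSup_nonneg fun _ => abs_nonneg _
  have hbdd : BddAbove (range fun z => ⨆ _ : z ∈ K, |dtm m p μ z ^ β - dtm m p ν z ^ β|) := by
    refine ⟨diam K ^ β, ?_⟩
    rintro _ ⟨z, rfl⟩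
    refine Real.iSup_le (fun hz => ?_) (Real.rpow_nonneg diam_nonneg β)
    have hle : ∀ (ρ : Measure (Euc d)) [IsProbabilityMeasure ρ], measSupport ρ ⊆ K →
        dtm m p ρ z ^ β ∈ Icc 0 (diam K ^ β) := fun ρ _ hρ =>
      ⟨Real.rpow_nonneg (dtm_nonneg hm0 p ρ z) β, Real.rpow_le_rpow (dtm_nonneg hm0 p ρ z)
        (dtm_le_diam hm hp hKc ρ hρ hz) (by linarith)⟩
    obtain ⟨h1, h2⟩ := hle μ hμsupp
    obtain ⟨h3, h4⟩ := hle ν hνsupp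
    exact abs_le.2 ⟨by linarith, by linarith⟩
  have hS : ∀ z ∈ K, |dtm m p μ z ^ β - dtm m p ν z ^ β| ≤ S := fun z hz =>
    (ciSup_pos (f := fun _ : z ∈ K => |dtm m p μ z ^ β - dtm m p ν z ^ β|) hz).ge.trans
      (le_ciSup hbdd z)
  by_cases hne : ∃ γ, AdmissiblePath F x y γ
  · refine abs_sub_le_iff.2 ⟨?_, ?_⟩
    · exact fdtm_sub_le hm hp hβ hKc hKconv μ ν hνsupp hFK hF hx hy hne hS0 hS
    · exact fdtm_sub_le hm hp hβ hKc hKconv ν μ hμsupp hFK hF hx hy hne hS0 fun z hz => by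
        rw [abs_sub_comm]
        exact hS z hz
  · have hzero : ∀ ρ : Measure (Euc d), fdtm m p β ρ F x y = 0 := fun ρ => by
      have hempty : {L : ℝ | ∃ γ : ℝ → Euc d, AdmissiblePath F x y γ ∧
          L = fdtmLength m p β ρ γ} = ∅ :=
        eq_empty_of_forall_notMem fun _ ⟨γ, hγ, _⟩ => hne ⟨γ, hγ⟩
      rw [fdtm, hempty, Real.sInf_empty]
    have hc : 0 ≤ fdtmConst m β := by
      have := scaleConst_pos (β := β) hm0
      exact le_trans (by positivity) (two_mul_scaleConst_le_fdtmConst hm hβ)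
    rw [hzero, hzero, sub_zero, abs_zero]
    exact mul_nonneg (mul_nonneg hc diam_nonneg) hS0

end
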